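/- The endomorphism ring Hom_R(H^c_I(ω_R), H^c_I(ω_R)) is a finitely generated R-module if and only if the socle Hom_R(𝕜, H^{d−c}_𝔪(H^c_I(ω_R))) is a finite-dimensional 𝕜-vector space. -/

import Mathlib

open CategoryTheory Opposite

set_option synthInstance.maxHeartbeats 1000000
set_option maxHeartbeats 1000000

noncomputable section

/-- The grade of an ideal: the maximal length of a regular sequence contained in it. -/
def idealGrade {A : Type} [CommRing A] (J : Ideal A) : ℕ∞ :=
  sSup {c : ℕ∞ | ∃ rs : List A, (∀ r ∈ rs, r ∈ J) ∧
    RingTheory.Sequence.IsRegular A rs ∧ (rs.length : ℕ∞) = c}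

/-- A canonical module of a `d`-dimensional local ring `A`: a finitely generated module `ω`
with `Ext_A^i(𝕜, ω) = 0` for `i ≠ d` and `Ext_A^d(𝕜, ω)` a one-dimensional `𝕜`-vector space
(equivalently, isomorphic to `𝕜` as an `A`-module), where `𝕜` is the residue field. -/
def IsCanonicalModule (A : Type) [CommRing A] [IsLocalRing A] (d : ℕ)
    (ω : ModuleCat A) : Prop :=
  Module.Finite A ω ∧
  (∀ i : ℕ, i ≠ d → Subsingleton
    (((Ext A (ModuleCat A) i).obj
      (op (ModuleCat.of A (IsLocalRing.ResidueField A)))).obj ω)) ∧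
  Nonempty ((((Ext A (ModuleCat A) d).obj
      (op (ModuleCat.of A (IsLocalRing.ResidueField A)))).obj ω)
    ≃ₗ[A] IsLocalRing.ResidueField A)

section

variable {R : Type} [CommRing R]

section Comparison

open CategoryTheory.Limits

/-- Homology of a cochain complex of modules is the quotient of the cycles
by any surjection from the cycles whose kernel consists of the boundaries. -/
lemma exists_homology_linearEquiv (K : CochainComplex (ModuleCat.{0} R) ℕ) (n : ℕ)
    {E : Type} [AddCommGroup E] [Module R E] (f : K.cycles n →ₗ[R] E)
    (hf : Function.Surjective f)
    (hker : ∀ z, f z = 0 ↔ ∃ y, K.toCycles ((ComplexShape.up ℕ).prev n) n y = z) :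
    ∃ e : K.homology n ≃ₗ[R] E, ∀ z, e (K.homologyπ n z) = f z := by
  have hex : (ShortComplex.mk (K.toCycles ((ComplexShape.up ℕ).prev n) n) (K.homologyπ n)
      (by simp)).Exact :=
    ShortComplex.exact_of_g_is_cokernel _ (K.homologyIsCokernel _ n rfl)
  rw [ShortComplex.moduleCat_exact_iff] at hex
  have hsurj : Function.Surjective (K.homologyπ n) :=
    (ModuleCat.epi_iff_surjective _).1 inferInstance
  have hk : LinearMap.ker f = LinearMap.ker (K.homologyπ n).hom := by
    ext z
    rw [LinearMap.mem_ker, LinearMap.mem_ker, hker]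
    constructor
    · rintro ⟨y, rfl⟩
      have := K.toCycles_comp_homologyπ ((ComplexShape.up ℕ).prev n) n
      exact congr($this y)
    · intro hz
      exact hex z hz
  let e₁ := (K.homologyπ n).hom.quotKerEquivOfSurjective hsurj
  let e₂ := f.quotKerEquivOfSurjective hf
  refine ⟨e₁.symm.trans ((Submodule.quotEquivOfEq _ _ hk.symm).trans e₂), fun z => ?_⟩
  have : e₁.symm (K.homologyπ n z) = Submodule.Quotient.mk z := by
    rw [LinearEquiv.symm_apply_eq]
    rfl
  simp only [LinearEquiv.trans_apply, this]
  rfl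

end Comparison

namespace CategoryTheory.ProjectiveResolution

open CategoryTheory.Limits CochainComplex HomComplex Abelian

lemma extMk_zero_eq_zero_iff {C : Type*} [Category* C] [Abelian C] [HasExt C] {X Y : C}
    (P : ProjectiveResolution X) (f : P.complex.X 0 ⟶ Y) (m : ℕ) (hm : 0 + 1 = m)
    (hf : P.complex.d m 0 ≫ f = 0) :
    P.extMk f m hm hf = 0 ↔ f = 0 := by
  refine ⟨fun h => ?_, by rintro rfl; simp⟩
  rw [← P.extEquivCohomologyClass.apply_eq_iff_eq,
    extEquivCohomologyClass_extMk, extEquivCohomologyClass_zero,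
    CohomologyClass.mk_eq_zero_iff,
    Cocycle.toSingleMk_mem_coboundaries_iff _ _ _ _ _ 1 (by lia)] at h
  obtain ⟨g, hg⟩ := h
  have hd : P.cochainComplex.d (-(0 : ℕ)) 1 = 0 :=
    IsZero.eq_of_tgt (by
      exact P.cochainComplex.isZero_of_isStrictlyLE 0 1 (by lia)) _ _
  rw [hd, zero_comp] at hg
  rw [← cancel_epi (P.cochainComplexXIso (-(0 : ℕ)) 0 rfl).hom, ← hg, comp_zero]

variable {R : Type} [CommRing R] {X X' : ModuleCat.{0} R} (P : ProjectiveResolution X)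
   (P' : ProjectiveResolution X')
  (Y : ModuleCat.{0} R) (n : ℕ)

/-- The morphism underlying a cocycle of `Hom(P, Y)`. -/
def cyclesHom (z : (P.complex.linearYonedaObj R Y).cycles n) : P.complex.X n ⟶ Y :=
  (P.complex.linearYonedaObj R Y).iCycles n z

lemma d_comp_cyclesHom (z : (P.complex.linearYonedaObj R Y).cycles n) :
    P.complex.d (n + 1) n ≫ P.cyclesHom Y n z = 0 := by
  have := (P.complex.linearYonedaObj R Y).iCycles_d n (n + 1)
  exact congr($this z)

/-- The class in `Ext` of a cocycle of `Hom(P, Y)`. -/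
def cyclesToExt : (P.complex.linearYonedaObj R Y).cycles n →ₗ[R] Abelian.Ext X Y n where
  toFun z := P.extMk (P.cyclesHom Y n z) (n + 1) rfl (P.d_comp_cyclesHom Y n z)
  map_add' z w := by
    rw [add_extMk]
    congr 1
    exact map_add ((P.complex.linearYonedaObj R Y).iCycles n).hom z w
  map_smul' r z := by
    rw [RingHom.id_apply, Ext.smul_eq_comp_mk₀, extMk_comp_mk₀]
    congr 1
    rw [Linear.comp_smul, Category.comp_id]
    exact map_smul ((P.complex.linearYonedaObj R Y).iCycles n).hom r z

lemma cyclesToExt_surjective : Function.Surjective (P.cyclesToExt Y n) := by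
  intro α
  obtain ⟨f, hf, rfl⟩ := P.extMk_surjective α (n + 1) rfl
  have h := (P.complex.linearYonedaObj R Y).i_cyclesMk (i := n) f (n + 1) (by simp) (by exact hf)
  refine ⟨(P.complex.linearYonedaObj R Y).cyclesMk f (n + 1) (by simp) (by exact hf), ?_⟩
  change P.extMk (P.cyclesHom Y n _) (n + 1) rfl (P.d_comp_cyclesHom Y n _) = _
  congr 1

lemma cyclesToExt_eq_zero_iff (z) : P.cyclesToExt Y n z = 0 ↔
    ∃ y, (P.complex.linearYonedaObj R Y).toCycles ((ComplexShape.up ℕ).prev n) n y = z := by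
  have hinj : Function.Injective ((P.complex.linearYonedaObj R Y).iCycles n) :=
    (ModuleCat.mono_iff_injective _).1 inferInstance
  have hcyc (i y) : (P.complex.linearYonedaObj R Y).iCycles n
      ((P.complex.linearYonedaObj R Y).toCycles i n y) =
        (P.complex.linearYonedaObj R Y).d i n y :=
    congr($((P.complex.linearYonedaObj R Y).toCycles_i i n) y)
  simp only [← hinj.eq_iff, hcyc]
  change P.extMk (P.cyclesHom Y n z) (n + 1) rfl (P.d_comp_cyclesHom Y n z) = 0 ↔ _
  cases n with
  | zero =>
    rw [extMk_zero_eq_zero_iff]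
    have : (P.complex.linearYonedaObj R Y).d ((ComplexShape.up ℕ).prev 0) 0 = 0 :=
      (P.complex.linearYonedaObj R Y).shape _ _ (by simp)
    rw [this]
    exact ⟨fun h => ⟨0, h.symm⟩, fun ⟨_, h⟩ => h.symm⟩
  | succ p =>
    rw [P.extMk_eq_zero_iff _ _ _ _ p rfl]
    have : (ComplexShape.up ℕ).prev (p + 1) = p := by simp
    rw [this]
    rfl

lemma exists_isoExt_linearEquiv_ext : ∃ e :
    (P.complex.linearYonedaObj R Y).homology n ≃ₗ[R] Abelian.Ext X Y n,
      ∀ z, e ((P.complex.linearYonedaObj R Y).homologyπ n z) = P.cyclesToExt Y n z :=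
  exists_homology_linearEquiv _ _ _ (P.cyclesToExt_surjective Y n)
    (P.cyclesToExt_eq_zero_iff Y n)

/-- Comparison of the two versions of `Ext`. -/
def extLinearEquiv : ((Ext R (ModuleCat.{0} R) n).obj (op X)).obj Y ≃ₗ[R] Abelian.Ext X Y n :=
  (P.isoExt n Y).toLinearEquiv.trans (P.exists_isoExt_linearEquiv_ext Y n).choose

variable {P P'}

lemma homologyUnop_inv_naturality {ι : Type*} {c : ComplexShape ι}
    {V : Type*} [Category* V] [Abelian V] {K L : HomologicalComplex Vᵒᵖ c} (f : K ⟶ L) (i : ι) :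
    (HomologicalComplex.homologyMap f i).unop ≫ (K.homologyUnop i).inv =
      (L.homologyUnop i).inv ≫
        HomologicalComplex.homologyMap ((HomologicalComplex.unopFunctor _ _).map f.op) i := by
  refine (Iso.eq_inv_comp _).2 ((Category.assoc _ _ _).symm.trans ((Iso.comp_inv_eq _).2 ?_))
  exact congr(($(HomologicalComplex.homologyOp_hom_naturality
    ((HomologicalComplex.unopFunctor _ _).map f.op) i)).unop)

lemma isoExt_hom_naturality {g : X ⟶ X'} (φ : Hom P P' g) :
    ((Ext R (ModuleCat.{0} R) n).map g.op).app Y ≫ (P.isoExt n Y).hom =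
    (P'.isoExt n Y).hom ≫ HomologicalComplex.homologyMap
      ((HomologicalComplex.unopFunctor _ _).map
        ((((linearYoneda R _).obj Y).rightOp.mapHomologicalComplex _).map φ.hom).op) n := by
  have h := isoLeftDerivedObj_inv_naturality g P P' φ.hom φ.hom_f_zero_comp_π_f_zero
    ((linearYoneda R _).obj Y).rightOp n
  have h' := congr(($h).unop)
  have h2 := homologyUnop_inv_naturality
    ((((linearYoneda R _).obj Y).rightOp.mapHomologicalComplex _).map φ.hom) n
  simp only [unop_comp] at h'
  change _ ≫ _ ≫ _ = (_ ≫ _) ≫ _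
  refine Eq.trans ?_ ((congr(_ ≫ $h2)).trans (Category.assoc _ _ _).symm)
  refine ((Category.assoc _ _ _).symm.trans ?_).trans (Category.assoc _ _ _)
  congr 1

lemma extLinearEquiv_naturality {g : X ⟶ X'} (φ : Hom P P' g) (x) :
    P.extLinearEquiv Y n (((Ext R (ModuleCat.{0} R) n).map g.op).app Y x) =
      (Ext.mk₀ g).comp (P'.extLinearEquiv Y n x) (zero_add _) := by
  have h := congr($(isoExt_hom_naturality Y n φ) x)
  obtain ⟨z, hz⟩ := (ModuleCat.epi_iff_surjective _).1
    (inferInstance : Epi ((P'.complex.linearYonedaObj R Y).homologyπ n)) ((P'.isoExt n Y).hom x)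
  have e1 := (P.exists_isoExt_linearEquiv_ext Y n).choose_spec
  have e2 := (P'.exists_isoExt_linearEquiv_ext Y n).choose_spec
  have e3 : P'.extLinearEquiv Y n x = P'.cyclesToExt Y n z := by
    rw [← e2, hz]; rfl
  let ψ : P'.complex.linearYonedaObj R Y ⟶ P.complex.linearYonedaObj R Y :=
      ((HomologicalComplex.unopFunctor _ _).map
        ((((linearYoneda R _).obj Y).rightOp.mapHomologicalComplex _).map φ.hom).op)
  have e4 : P.extLinearEquiv Y n (((Ext R (ModuleCat.{0} R) n).map g.op).app Y x) =
      P.cyclesToExt Y n (HomologicalComplex.cyclesMap ψ n z) := by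
    rw [← e1, extLinearEquiv, LinearEquiv.trans_apply]
    congr 1
    have h3 := congr($(HomologicalComplex.homologyπ_naturality ψ n) z)
    refine h.trans ?_
    refine Eq.trans ?_ h3
    exact congr(HomologicalComplex.homologyMap ψ n $hz).symm
  rw [e3, e4]
  change P.extMk (P.cyclesHom Y n _) (n + 1) rfl (P.d_comp_cyclesHom Y n _) =
    (Ext.mk₀ g).comp (P'.extMk (P'.cyclesHom Y n _) (n + 1) rfl (P'.d_comp_cyclesHom Y n _)) _
  rw [mk₀_comp_extMk _ _ _ _ φ]
  congr 1
  exact congr($(HomologicalComplex.cyclesMap_i ψ n) z)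

end CategoryTheory.ProjectiveResolution

namespace CategoryTheory.ProjectiveResolution

/-- A lift of a morphism to projective resolutions. -/
def liftHom {C : Type*} [Category* C] [Abelian C] {X Y : C} (f : X ⟶ Y)
    (P : ProjectiveResolution X) (Q : ProjectiveResolution Y) : Hom P Q f where
  hom := lift f P Q
  hom_f_zero_comp_π_f_zero := by
    have h := congr(($(lift_commutes f P Q)).f 0)
    exact h

end CategoryTheory.ProjectiveResolution

/-- The module `R ⧸ I ^ t`. -/
abbrev powQuot (I : Ideal R) (t : ℕ) : ModuleCat.{0} R := ModuleCat.of R (R ⧸ I ^ t)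

/-- The projection `R ⧸ I ^ t ⟶ R ⧸ I ^ s` for `s ≤ t`. -/
def powQuotMap (I : Ideal R) {s t : ℕ} (h : s ≤ t) : powQuot I t ⟶ powQuot I s :=
  ModuleCat.ofHom (Submodule.mapQ _ _ LinearMap.id (Ideal.pow_le_pow_right h))

/-- Restriction of `Ext`-classes along a morphism in the first variable. -/
abbrev extRes {X Y : ModuleCat.{0} R} (f : X ⟶ Y) {M : ModuleCat.{0} R} {n : ℕ}
    (α : Abelian.Ext Y M n) : Abelian.Ext X M n :=
  (Abelian.Ext.mk₀ f).comp α (zero_add n)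

/-- The compatible family of maps `ι t : Ext^n(R ⧸ I ^ t, M) → H` exhibits `H` as the `n`-th
local cohomology module of `M` with support in `I`. -/
structure IsLocalCohomology (I : Ideal R) (n : ℕ) (M : ModuleCat.{0} R) {H : Type}
    [AddCommGroup H] [Module R H] (ι : ∀ t, Abelian.Ext (powQuot I t) M n →ₗ[R] H) : Prop where
  compat : ∀ {s t : ℕ} (h : s ≤ t) (α), ι t (extRes (powQuotMap I h) α) = ι s α
  surj : ∀ x, ∃ t α, ι t α = x
  eq_zero : ∀ t α, ι t α = 0 → ∃ (s : ℕ) (h : t ≤ s), extRes (powQuotMap I h) α = 0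

open Limits in
theorem exists_isLocalCohomology (I : Ideal R) (n : ℕ) (M : ModuleCat.{0} R) :
    ∃ ι, IsLocalCohomology I n M (H := (localCohomology I n).obj M) ι := by
  let D := localCohomology.diagram (localCohomology.idealPowersDiagram I) n
  let F := D ⋙ (evaluation (ModuleCat.{0} R) (ModuleCat.{0} R)).obj M
  let c : Cocone F := ((evaluation (ModuleCat.{0} R) (ModuleCat.{0} R)).obj M).mapCocone
    (colimit.cocone D)
  have hc : IsColimit c := isColimitOfPreserves _ (colimit.isColimit D)
  have hc' : c.pt = (localCohomology I n).obj M := rfl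
  let P (t : ℕ) := projectiveResolution (powQuot I t)
  let e (t : ℕ) : F.obj (op (op t)) ≃ₗ[R] Abelian.Ext (powQuot I t) M n :=
    (P t).extLinearEquiv M n
  have he {s t : ℕ} (h : s ≤ t) (x : F.obj (op (op s))) :
      e t (F.map (homOfLE h).op.op x) = extRes (powQuotMap I h) (e s x) :=
    ProjectiveResolution.extLinearEquiv_naturality M n
      (ProjectiveResolution.liftHom (powQuotMap I h) (P t) (P s)) x
  let ι (t : ℕ) : Abelian.Ext (powQuot I t) M n →ₗ[R] (localCohomology I n).obj M :=
    (c.ι.app (op (op t))).hom ∘ₗ (e t).symm.toLinearMap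
  have hι (t : ℕ) (x) : ι t (e t x) = c.ι.app (op (op t)) x :=
    congrArg (c.ι.app (op (op t))) ((e t).symm_apply_apply x)
  refine ⟨ι, fun {s t} h α => ?_, fun x => ?_, fun t α h => ?_⟩
  · obtain ⟨x, rfl⟩ := (e s).surjective α
    rw [← he, hι, hι]
    exact congr($(c.w (homOfLE h).op.op) x)
  · obtain ⟨t, y, hy⟩ := Concrete.isColimit_exists_rep F hc x
    exact ⟨t.unop.unop, e _ y, (hι _ _).trans hy⟩
  · obtain ⟨x, rfl⟩ := (e t).surjective α
    rw [hι] at h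
    have h0 : c.ι.app (op (op t)) x = c.ι.app (op (op t)) 0 := by
      rw [map_zero]; exact h
    rw [Concrete.isColimit_rep_eq_iff_exists F hc] at h0
    obtain ⟨k, f, g, hfg⟩ := h0
    have hle : t ≤ k.unop.unop := f.unop.unop.le
    refine ⟨k.unop.unop, hle, ?_⟩
    have : (homOfLE hle).op.op = f := Subsingleton.elim _ _
    rw [← he hle, this, hfg, map_zero, map_zero]

lemma powQuotMap_comp (I : Ideal R) {s t u : ℕ} (h : s ≤ t) (h' : t ≤ u) :
    powQuotMap I h' ≫ powQuotMap I h = powQuotMap I (h.trans h') := by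
  ext
  rfl

lemma extRes_extRes {X Y Z M : ModuleCat.{0} R} (f : X ⟶ Y) (g : Y ⟶ Z) {n : ℕ}
    (α : Abelian.Ext Z M n) : extRes f (extRes g α) = extRes (f ≫ g) α :=
  Abelian.Ext.mk₀_comp_mk₀_assoc f g α

lemma extRes_powQuotMap (I : Ideal R) {s t u : ℕ} (h : s ≤ t) (h' : t ≤ u) {M : ModuleCat.{0} R}
    {n : ℕ} (α : Abelian.Ext (powQuot I s) M n) :
    extRes (powQuotMap I h') (extRes (powQuotMap I h) α) = extRes (powQuotMap I (h.trans h')) α := by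
  rw [extRes_extRes, powQuotMap_comp]

lemma extRes_comp {X Y M N : ModuleCat.{0} R} (f : X ⟶ Y) {a b c : ℕ} (α : Abelian.Ext Y M a)
    (β : Abelian.Ext M N b) (h : a + b = c) :
    extRes f (α.comp β h) = (extRes f α).comp β h :=
  (Abelian.Ext.comp_assoc _ _ _ (zero_add a) h (by lia)).symm

lemma extRes_zero {X Y M : ModuleCat.{0} R} (f : X ⟶ Y) {n : ℕ} :
    extRes f (0 : Abelian.Ext Y M n) = 0 :=
  Abelian.Ext.comp_zero _ _ _ _ _

lemma extRes_sub {X Y M : ModuleCat.{0} R} (f : X ⟶ Y) {n : ℕ} (α β : Abelian.Ext Y M n) :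
    extRes f (α - β) = extRes f α - extRes f β :=
  map_sub (Abelian.Ext.precompOfLinear (Abelian.Ext.mk₀ f) R M (zero_add n)) α β

lemma smul_eq_extRes {X M : ModuleCat.{0} R} {n : ℕ} (r : R) (α : Abelian.Ext X M n) :
    r • α = extRes (r • 𝟙 X) α := by
  rw [extRes, Abelian.Ext.mk₀_smul, Abelian.Ext.smul_comp, Abelian.Ext.mk₀_id_comp]

/-- If a family of maps `φ t : Ext^n(R ⧸ I ^ t, C) → Ext^m(R ⧸ I ^ t, M)` is an isomorphism of
ind-objects, then the local cohomology of `M` is the local cohomology of `C`. -/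
lemma IsLocalCohomology.transport {I : Ideal R} {n m : ℕ} {M C : ModuleCat.{0} R}
    {H : Type} [AddCommGroup H] [Module R H] {ι : ∀ t, Abelian.Ext (powQuot I t) M m →ₗ[R] H}
    (hι : IsLocalCohomology I m M ι)
    (φ : ∀ t, Abelian.Ext (powQuot I t) C n →ₗ[R] Abelian.Ext (powQuot I t) M m)
    (nat : ∀ {s t : ℕ} (h : s ≤ t) (α),
      φ t (extRes (powQuotMap I h) α) = extRes (powQuotMap I h) (φ s α))
    (inj : ∀ t α, φ t α = 0 → ∃ (s : ℕ) (h : t ≤ s), extRes (powQuotMap I h) α = 0)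
    (surj : ∀ t β, ∃ (s : ℕ) (h : t ≤ s) (α : _), φ s α = extRes (powQuotMap I h) β) :
    IsLocalCohomology I n C (fun t => ι t ∘ₗ φ t) where
  compat h α := by simp only [LinearMap.comp_apply, nat, hι.compat]
  surj x := by
    obtain ⟨t, β, rfl⟩ := hι.surj x
    obtain ⟨s, h, α, hα⟩ := surj t β
    exact ⟨s, α, by rw [LinearMap.comp_apply, hα, hι.compat]⟩
  eq_zero t α h := by
    obtain ⟨s, hs, hα⟩ := hι.eq_zero t _ h
    rw [← nat] at hα
    obtain ⟨u, hu, hα⟩ := inj s _ hα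
    exact ⟨u, hs.trans hu, by rwa [extRes_powQuotMap] at hα⟩

lemma IsLocalCohomology.exists_hom {I : Ideal R} {n : ℕ} {M : ModuleCat.{0} R}
    {H H' : Type} [AddCommGroup H] [Module R H] [AddCommGroup H'] [Module R H']
    {ι : ∀ t, Abelian.Ext (powQuot I t) M n →ₗ[R] H}
    {ι' : ∀ t, Abelian.Ext (powQuot I t) M n →ₗ[R] H'}
    (hι : IsLocalCohomology I n M ι) (hι' : IsLocalCohomology I n M ι') :
    ∃ f : H →ₗ[R] H', ∀ t α, f (ι t α) = ι' t α := by
  choose t α hα using hι.surj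
  have key {s₁ s₂ : ℕ} (α₁ α₂) (h : ι s₁ α₁ = ι s₂ α₂) : ι' s₁ α₁ = ι' s₂ α₂ := by
    have h0 : ι (max s₁ s₂) (extRes (powQuotMap I (le_max_left s₁ s₂)) α₁ -
        extRes (powQuotMap I (le_max_right s₁ s₂)) α₂) = 0 := by
      rw [map_sub, hι.compat, hι.compat, h, sub_self]
    obtain ⟨u, hu, h1⟩ := hι.eq_zero _ _ h0
    rw [extRes_sub, extRes_powQuotMap, extRes_powQuotMap, sub_eq_zero] at h1
    rw [← hι'.compat ((le_max_left s₁ s₂).trans hu), h1, hι'.compat]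
  refine ⟨{ toFun x := ι' (t x) (α x), map_add' x y := ?_, map_smul' r x := ?_ }, ?_⟩
  · rw [← hι'.compat (le_max_left (t x) (t y)), ← hι'.compat (le_max_right (t x) (t y)) (α y),
      ← map_add]
    exact key _ _ (by rw [hα, map_add, hι.compat, hι.compat, hα, hα])
  · rw [RingHom.id_apply, ← map_smul]
    exact key _ _ (by rw [hα, map_smul, hα])
  · intro s β
    exact key _ _ (by rw [hα])

lemma IsLocalCohomology.nonempty_linearEquiv {I : Ideal R} {n : ℕ} {M : ModuleCat.{0} R}
    {H H' : Type} [AddCommGroup H] [Module R H] [AddCommGroup H'] [Module R H']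
    {ι : ∀ t, Abelian.Ext (powQuot I t) M n →ₗ[R] H}
    {ι' : ∀ t, Abelian.Ext (powQuot I t) M n →ₗ[R] H'}
    (hι : IsLocalCohomology I n M ι) (hι' : IsLocalCohomology I n M ι') :
    Nonempty (H ≃ₗ[R] H') := by
  obtain ⟨f, hf⟩ := hι.exists_hom hι'
  obtain ⟨g, hg⟩ := hι'.exists_hom hι
  refine ⟨LinearEquiv.ofLinearMap f g ?_ ?_⟩
  · ext x
    obtain ⟨t, α, rfl⟩ := hι'.surj x
    simp [hf, hg]
  · ext x
    obtain ⟨t, α, rfl⟩ := hι.surj x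
    simp [hf, hg]

/-- The elements of `M` annihilated by some power of `I`. -/
def idealTorsion (I : Ideal R) (M : Type) [AddCommGroup M] [Module R M] : Submodule R M where
  carrier := {x | ∃ t : ℕ, ∀ r ∈ I ^ t, r • x = 0}
  zero_mem' := ⟨0, fun r _ => smul_zero r⟩
  add_mem' := by
    rintro x y ⟨s, hs⟩ ⟨t, ht⟩
    exact ⟨max s t, fun r hr => by
      rw [smul_add, hs r (Ideal.pow_le_pow_right (le_max_left s t) hr),
        ht r (Ideal.pow_le_pow_right (le_max_right s t) hr), add_zero]⟩
  smul_mem' := by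
    rintro a x ⟨s, hs⟩
    exact ⟨s, fun r hr => by rw [smul_comm, hs r hr, smul_zero]⟩

/-- Every element of `M` is annihilated by some power of `I`. -/
def IsIdealTorsion (I : Ideal R) (M : Type) [AddCommGroup M] [Module R M] : Prop :=
  ∀ x : M, ∃ t : ℕ, ∀ r ∈ I ^ t, r • x = 0

lemma isIdealTorsion_idealTorsion (I : Ideal R) (M : Type) [AddCommGroup M] [Module R M] :
    IsIdealTorsion I (idealTorsion I M) := by
  rintro ⟨x, t, ht⟩
  exact ⟨t, fun r hr => Subtype.ext (ht r hr)⟩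

lemma IsIdealTorsion.of_injective {I : Ideal R} {M N : Type} [AddCommGroup M] [Module R M]
    [AddCommGroup N] [Module R N] (h : IsIdealTorsion I N) (f : M →ₗ[R] N)
    (hf : Function.Injective f) : IsIdealTorsion I M := fun x => by
  obtain ⟨t, ht⟩ := h (f x)
  exact ⟨t, fun r hr => hf (by rw [map_smul, ht r hr, map_zero])⟩

lemma IsIdealTorsion.of_surjective {I : Ideal R} {M N : Type} [AddCommGroup M] [Module R M]
    [AddCommGroup N] [Module R N] (h : IsIdealTorsion I M) (f : M →ₗ[R] N)
    (hf : Function.Surjective f) : IsIdealTorsion I N := fun y => by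
  obtain ⟨x, rfl⟩ := hf y
  obtain ⟨t, ht⟩ := h x
  exact ⟨t, fun r hr => by rw [← map_smul, ht r hr, map_zero]⟩

lemma isIdealTorsion_powQuot (I : Ideal R) (t : ℕ) : IsIdealTorsion I (powQuot I t) := fun x => by
  obtain ⟨x, rfl⟩ := Ideal.Quotient.mk_surjective x
  exact ⟨t, fun r hr => Ideal.Quotient.eq_zero_iff_mem.2 (Ideal.mul_mem_right _ _ hr)⟩

lemma IsLocalCohomology.isIdealTorsion {I : Ideal R} {n : ℕ} {M : ModuleCat.{0} R}
    {H : Type} [AddCommGroup H] [Module R H] {ι : ∀ t, Abelian.Ext (powQuot I t) M n →ₗ[R] H}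
    (hι : IsLocalCohomology I n M ι) : IsIdealTorsion I H := fun x => by
  obtain ⟨t, α, rfl⟩ := hι.surj x
  refine ⟨t, fun r hr => ?_⟩
  have : r • 𝟙 (powQuot I t) = 0 := by
    refine ModuleCat.hom_ext (LinearMap.ext fun y => ?_)
    obtain ⟨y, rfl⟩ := Ideal.Quotient.mk_surjective y
    exact Ideal.Quotient.eq_zero_iff_mem.2 (Ideal.mul_mem_right _ _ hr)
  rw [← map_smul, smul_eq_extRes, this, extRes, Abelian.Ext.mk₀_zero, Abelian.Ext.zero_comp,
    map_zero]

/-- `Q` has no cohomology with support in `V(I)`. -/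
def IsIdealLocal (I : Ideal R) (Q : ModuleCat.{0} R) : Prop :=
  ∀ N : ModuleCat.{0} R, IsIdealTorsion I N → ∀ i, Subsingleton (Abelian.Ext N Q i)

open Abelian in
lemma bijective_comp_extClass {S : ShortComplex (ModuleCat.{0} R)} (hS : S.ShortExact)
    (N : ModuleCat.{0} R) (n : ℕ) (h : Subsingleton (Abelian.Ext N S.X₂ n))
    (h' : Subsingleton (Abelian.Ext N S.X₂ (n + 1))) :
    Function.Bijective (Ext.postcompOfLinear hS.extClass R N (rfl : n + 1 = n + 1)) := by
  constructor
  · rw [injective_iff_map_eq_zero]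
    intro α hα
    obtain ⟨β, rfl⟩ := Ext.covariant_sequence_exact₃ N hS α rfl hα
    rw [Subsingleton.elim β 0, Ext.zero_comp]
  · intro β
    exact Ext.covariant_sequence_exact₁ N hS β (Subsingleton.elim _ _) rfl

open Abelian in
lemma bijective_extClass_comp {S : ShortComplex (ModuleCat.{0} R)} (hS : S.ShortExact)
    (N : ModuleCat.{0} R) (n : ℕ) (h : Subsingleton (Abelian.Ext S.X₂ N n))
    (h' : Subsingleton (Abelian.Ext S.X₂ N (n + 1))) :
    Function.Bijective (Ext.precompOfLinear hS.extClass R N (add_comm 1 n)) := by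
  constructor
  · rw [injective_iff_map_eq_zero]
    intro α hα
    obtain ⟨β, rfl⟩ := Ext.contravariant_sequence_exact₁ hS N α (add_comm 1 n) hα
    rw [Subsingleton.elim β 0, Ext.comp_zero]
  · intro β
    exact Ext.contravariant_sequence_exact₃ hS N β (Subsingleton.elim _ _) (add_comm 1 n)

lemma IsLocalCohomology.shift {I : Ideal R} {n : ℕ} {S : ShortComplex (ModuleCat.{0} R)}
    (hS : S.ShortExact) (hQ : IsIdealLocal I S.X₂) {H : Type} [AddCommGroup H] [Module R H]
    {ι : ∀ t, Abelian.Ext (powQuot I t) S.X₁ (n + 1) →ₗ[R] H}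
    (hι : IsLocalCohomology I (n + 1) S.X₁ ι) : ∃ ι', IsLocalCohomology I n S.X₃ (H := H) ι' := by
  have hb (t : ℕ) := bijective_comp_extClass hS (powQuot I t) n
    (hQ _ (isIdealTorsion_powQuot I t) _) (hQ _ (isIdealTorsion_powQuot I t) _)
  refine ⟨_, hι.transport (fun t => Abelian.Ext.postcompOfLinear hS.extClass R (powQuot I t) rfl)
    (fun {s t} h α => ?_) (fun t α h => ⟨t, le_rfl, ?_⟩) (fun t β => ⟨t, le_rfl, ?_⟩)⟩
  · exact (extRes_comp _ α hS.extClass rfl).symm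
  · rw [(injective_iff_map_eq_zero _).1 (hb t).1 α h, extRes_zero]
  · exact (hb t).2 _

lemma isLocalCohomology_zero (I : Ideal R) (M : ModuleCat.{0} R) :
    ∃ ι, IsLocalCohomology I 0 M (H := idealTorsion I M) ι := by
  let ι (t : ℕ) : Abelian.Ext (powQuot I t) M 0 →ₗ[R] idealTorsion I M :=
    { toFun α := ⟨(Abelian.Ext.linearEquiv₀ (R := R) α).hom (Ideal.Quotient.mk _ 1), t, fun r hr => by
        rw [← map_smul]
        have : r • (Ideal.Quotient.mk (I ^ t) 1) = 0 :=
          Ideal.Quotient.eq_zero_iff_mem.2 (Ideal.mul_mem_right _ _ hr)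
        rw [this, map_zero]⟩
      map_add' α β := by
        ext
        rw [map_add]
        rfl
      map_smul' r α := by
        ext
        rw [map_smul]
        rfl }
  have hι (t : ℕ) (f : powQuot I t ⟶ M) : (ι t (Abelian.Ext.mk₀ f) : M) =
      f.hom (Ideal.Quotient.mk _ 1) := by
    have : Abelian.Ext.linearEquiv₀ (R := R) (Abelian.Ext.mk₀ f) = f :=
      Abelian.Ext.linearEquiv₀.apply_symm_apply f
    exact congr(ModuleCat.Hom.hom $this (Ideal.Quotient.mk _ 1))
  refine ⟨ι, fun {s t} h α => ?_, ?_, ?_⟩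
  · obtain ⟨f, rfl⟩ := (Abelian.Ext.mk₀_bijective _ _).2 α
    ext
    rw [extRes, Abelian.Ext.mk₀_comp_mk₀, hι, hι]
    rfl
  · rintro ⟨x, t, hx⟩
    refine ⟨t, Abelian.Ext.mk₀ (ModuleCat.ofHom (Submodule.liftQ (I ^ t)
      (LinearMap.toSpanSingleton R M x) hx)), ?_⟩
    ext
    rw [hι]
    exact one_smul R x
  · intro t α h
    obtain ⟨f, rfl⟩ := (Abelian.Ext.mk₀_bijective _ _).2 α
    have : f = 0 := by
      ext
      change f.hom (Ideal.Quotient.mk _ 1) = 0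
      rw [← hι, h]
      rfl
    exact ⟨t, le_rfl, by rw [this, Abelian.Ext.mk₀_zero, extRes_zero]⟩

lemma IsIdealTorsion.exists_pow_smul_eq_zero {I : Ideal R} {M : Type} [AddCommGroup M] [Module R M]
    [Module.Finite R M] (h : IsIdealTorsion I M) : ∃ k : ℕ, ∀ r ∈ I ^ k, ∀ x : M, r • x = 0 := by
  have key : ∀ N : Submodule R M, N.FG → ∃ k : ℕ, ∀ r ∈ I ^ k, ∀ x ∈ N, r • x = 0 := by
    intro N hN
    induction N, hN using Submodule.fg_induction with
    | singleton x =>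
      obtain ⟨k, hk⟩ := h x
      refine ⟨k, fun r hr y hy => ?_⟩
      obtain ⟨a, rfl⟩ := Submodule.mem_span_singleton.1 hy
      rw [smul_comm, hk r hr, smul_zero]
    | sup N₁ N₂ _ _ h₁ h₂ =>
      obtain ⟨k₁, h₁⟩ := h₁
      obtain ⟨k₂, h₂⟩ := h₂
      refine ⟨max k₁ k₂, fun r hr y hy => ?_⟩
      obtain ⟨y₁, hy₁, y₂, hy₂, rfl⟩ := Submodule.mem_sup.1 hy
      rw [smul_add, h₁ r (Ideal.pow_le_pow_right (le_max_left _ _) hr) y₁ hy₁,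
        h₂ r (Ideal.pow_le_pow_right (le_max_right _ _) hr) y₂ hy₂, add_zero]
  obtain ⟨k, hk⟩ := key ⊤ Module.Finite.fg_top
  exact ⟨k, fun r hr x => hk r hr x trivial⟩

lemma injective_idealTorsion [IsNoetherianRing R] (I : Ideal R) (J : Type) [AddCommGroup J]
    [Module R J] [Module.Injective R J] : Module.Injective R (idealTorsion I J) := by
  refine Module.Baer.injective fun 𝔞 f => ?_
  obtain ⟨k, hk⟩ := ((isIdealTorsion_idealTorsion I J).of_injective
    (LinearMap.range f).subtype Subtype.val_injective).exists_pow_smul_eq_zero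
  obtain ⟨n₀, hn₀⟩ := Ideal.exists_pow_inf_eq_pow_smul I (M := R) 𝔞
  let u : 𝔞 →ₗ[R] R ⧸ I ^ (n₀ + k) := (I ^ (n₀ + k)).mkQ ∘ₗ 𝔞.subtype
  have hu : LinearMap.ker u ≤ LinearMap.ker ((idealTorsion I J).subtype ∘ₗ f) := by
    intro x hx
    have hx1 : (x : R) ∈ I ^ (n₀ + k) :=
      (Submodule.Quotient.mk_eq_zero _).1 (show (I ^ (n₀ + k)).mkQ (x : R) = 0 from hx)
    have hx2 : (x : R) ∈ I ^ k • 𝔞 := by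
      have h1 : (x : R) ∈ I ^ (n₀ + k) • (⊤ : Submodule R R) ⊓ 𝔞 :=
        ⟨by rw [smul_eq_mul, Ideal.mul_top]; exact hx1, x.2⟩
      rw [hn₀ _ (Nat.le_add_right _ _), Nat.add_sub_cancel_left] at h1
      exact Submodule.smul_mono le_rfl inf_le_right h1
    have hx3 : x ∈ I ^ k • (⊤ : Submodule R 𝔞) := by
      have h2 : (x : R) ∈ (I ^ k • (⊤ : Submodule R 𝔞)).map 𝔞.subtype := by
        rwa [Submodule.map_smul'', Submodule.map_top, Submodule.range_subtype]
      obtain ⟨y, hy, hyx⟩ := h2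
      rwa [← Subtype.ext (show (y : R) = x from hyx)]
    have hx4 : f x = 0 := by
      refine Submodule.smul_induction_on hx3 (fun r hr y _ => ?_) (fun y z hy hz => ?_)
      · rw [map_smul]
        exact congrArg Subtype.val (hk r hr ⟨f y, y, rfl⟩)
      · rw [map_add, hy, hz, add_zero]
    simp [hx4]
  obtain ⟨h, hh⟩ := Module.Injective.out (R := R) (Q := J) ((LinearMap.ker u).liftQ u le_rfl)
    (by rw [← LinearMap.ker_eq_bot, Submodule.ker_liftQ_eq_bot' _ _ rfl])
    ((LinearMap.ker u).liftQ ((idealTorsion I J).subtype ∘ₗ f) hu)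
  refine ⟨(h ∘ₗ (I ^ (n₀ + k)).mkQ).codRestrict _ fun x => ⟨n₀ + k, fun r hr => ?_⟩, ?_⟩
  · rw [← map_smul, LinearMap.comp_apply]
    have : (I ^ (n₀ + k)).mkQ (r • x) = 0 :=
      (Submodule.Quotient.mk_eq_zero _).2 (Ideal.mul_mem_right _ _ hr)
    rw [this, map_zero]
  · intro x hx
    ext
    exact hh (Submodule.Quotient.mk ⟨x, hx⟩)

/-- The short complex `N ⟶ M ⟶ M ⧸ N`. -/
abbrev quotSES {M : ModuleCat.{0} R} (N : Submodule R M) : ShortComplex (ModuleCat.{0} R) where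
  X₁ := ModuleCat.of R N
  X₂ := M
  X₃ := ModuleCat.of R (M ⧸ N)
  f := ModuleCat.ofHom N.subtype
  g := ModuleCat.ofHom N.mkQ
  zero := ModuleCat.hom_ext (LinearMap.ext fun x => (Submodule.Quotient.mk_eq_zero _).2 x.2)

lemma quotSES_shortExact {M : ModuleCat.{0} R} (N : Submodule R M) : (quotSES N).ShortExact :=
  ModuleCat.shortComplex_shortExact _ (LinearMap.exact_subtype_mkQ N) Subtype.val_injective
    N.mkQ_surjective

/-- The short complex `M ⟶ Q ⟶ coker f`. -/
abbrev cokerSES {M Q : ModuleCat.{0} R} (f : M ⟶ Q) : ShortComplex (ModuleCat.{0} R) where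
  X₁ := M
  X₂ := Q
  X₃ := ModuleCat.of R (Q ⧸ LinearMap.range f.hom)
  f := f
  g := ModuleCat.ofHom (LinearMap.range f.hom).mkQ
  zero := ModuleCat.hom_ext (LinearMap.ext fun x => (Submodule.Quotient.mk_eq_zero _).2 ⟨x, rfl⟩)

lemma cokerSES_shortExact {M Q : ModuleCat.{0} R} (f : M ⟶ Q) (hf : Function.Injective f.hom) :
    (cokerSES f).ShortExact :=
  ModuleCat.shortComplex_shortExact _ (LinearMap.exact_map_mkQ_range f.hom) hf
    (Submodule.mkQ_surjective _)

lemma exists_injective_embedding (M : ModuleCat.{0} R) :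
    ∃ (J : ModuleCat.{0} R) (f : M ⟶ J), Injective J ∧ Function.Injective f.hom :=
  ⟨Injective.under M, Injective.ι M, inferInstance,
    (ModuleCat.mono_iff_injective _).1 inferInstance⟩

open Abelian in
lemma subsingleton_ext_of_injective (N J : ModuleCat.{0} R) [Injective J] (i : ℕ) :
    Subsingleton (Abelian.Ext N J (i + 1)) :=
  subsingleton_of_forall_eq 0 fun α => Ext.eq_zero_of_injective α

lemma Module.Injective.of_category {J : ModuleCat.{0} R} (h : CategoryTheory.Injective J) :
    Module.Injective R J := Module.injective_module_of_injective_object R J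

lemma injective_of_idealTorsion [IsNoetherianRing R] (I : Ideal R) {J : ModuleCat.{0} R}
    (hJ : Injective J) : Injective (ModuleCat.of R (idealTorsion I J)) := by
  have := Module.Injective.of_category hJ
  have := injective_idealTorsion I J
  exact Module.injective_object_of_injective_module R (idealTorsion I J)

open Abelian in
lemma isIdealLocal_quotient [IsNoetherianRing R] (I : Ideal R) {J : ModuleCat.{0} R}
    (hJ : Injective J) : IsIdealLocal I (ModuleCat.of R (J ⧸ idealTorsion I J)) := by
  have h1 := injective_of_idealTorsion I hJ
  have hS := quotSES_shortExact (idealTorsion I J)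
  intro N hN i
  refine subsingleton_of_forall_eq 0 fun (α : Abelian.Ext N (quotSES (idealTorsion I J)).X₃ i) => ?_
  obtain ⟨β, rfl⟩ := Ext.covariant_sequence_exact₃ N hS α rfl
    ((subsingleton_ext_of_injective N (ModuleCat.of R (idealTorsion I J)) i).elim _ _)
  cases i with
  | zero =>
    obtain ⟨f, rfl⟩ := (Abelian.Ext.mk₀_bijective _ _).2 β
    rw [Ext.mk₀_comp_mk₀]
    have : f ≫ (quotSES (idealTorsion I J)).g = 0 := by
      refine ModuleCat.hom_ext (LinearMap.ext fun x => (Submodule.Quotient.mk_eq_zero _).2 ?_)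
      obtain ⟨t, ht⟩ := hN x
      exact ⟨t, fun r hr => by rw [← map_smul, ht r hr, map_zero]⟩
    rw [this, Ext.mk₀_zero]
  | succ i =>
    rw [(subsingleton_ext_of_injective N J i).elim β 0, Ext.zero_comp]

lemma exists_local_embedding [IsNoetherianRing R] (I : Ideal R) {M : ModuleCat.{0} R}
    (hM : idealTorsion I M = ⊥) : ∃ (J : ModuleCat.{0} R)
      (f : M ⟶ ModuleCat.of R (J ⧸ idealTorsion I J)), Injective J ∧ Function.Injective f.hom := by
  obtain ⟨J, f, hJ, hf⟩ := exists_injective_embedding M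
  refine ⟨J, f ≫ ModuleCat.ofHom (idealTorsion I J).mkQ, hJ, ?_⟩
  refine (injective_iff_map_eq_zero _).2 fun x hx => ?_
  obtain ⟨t, ht⟩ := (Submodule.Quotient.mk_eq_zero _).1 hx
  have : x ∈ idealTorsion I M := ⟨t, fun r hr => hf (by rw [map_smul, map_zero]; exact ht r hr)⟩
  rwa [hM] at this

lemma exists_torsion_embedding [IsNoetherianRing R] (I : Ideal R) {T : ModuleCat.{0} R}
    (hT : IsIdealTorsion I T) : ∃ (J : ModuleCat.{0} R) (f : T ⟶ J),
      IsIdealTorsion I J ∧ Injective J ∧ Function.Injective f.hom := by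
  obtain ⟨J, f, hJ, hf⟩ := exists_injective_embedding T
  refine ⟨ModuleCat.of R (idealTorsion I J),
    ModuleCat.ofHom (f.hom.codRestrict _ fun x => ?_), isIdealTorsion_idealTorsion I J,
    injective_of_idealTorsion I hJ, fun x y h => hf (congrArg Subtype.val h)⟩
  obtain ⟨t, ht⟩ := hT x
  exact ⟨t, fun r hr => by rw [← map_smul, ht r hr, map_zero]⟩

open Abelian in
/-- Positive degree `Ext`-classes from `R ⧸ I ^ t` to an `I`-torsion module are effaceable
by increasing `t`. -/
lemma exists_extRes_powQuotMap_eq_zero [IsNoetherianRing R] (I : Ideal R) (j : ℕ) :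
    ∀ {T : ModuleCat.{0} R} (_ : IsIdealTorsion I T) (t : ℕ)
      (α : Abelian.Ext (powQuot I t) T (j + 1)),
      ∃ (s : ℕ) (h : t ≤ s), extRes (powQuotMap I h) α = 0 := by
  induction j with
  | zero =>
    intro T hT t α
    obtain ⟨J, f, hJT, hJ, hf⟩ := exists_torsion_embedding I hT
    have hS := cokerSES_shortExact f hf
    obtain ⟨β, rfl⟩ := Ext.covariant_sequence_exact₁ _ hS α
      ((subsingleton_ext_of_injective _ J 0).elim _ _) rfl
    obtain ⟨b, rfl⟩ := (Abelian.Ext.mk₀_bijective _ _).2 β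
    obtain ⟨y, hy⟩ := (LinearMap.range f.hom).mkQ_surjective (b.hom (Ideal.Quotient.mk _ 1))
    obtain ⟨s, hs⟩ := hJT y
    have hs' : ∀ r ∈ I ^ (max t s), r • y = 0 :=
      fun r hr => hs r (Ideal.pow_le_pow_right (le_max_right t s) hr)
    refine ⟨max t s, le_max_left t s, ?_⟩
    let γ : powQuot I (max t s) ⟶ J :=
      ModuleCat.ofHom (Submodule.liftQ (I ^ (max t s)) (LinearMap.toSpanSingleton R J y) hs')
    have hγ : powQuotMap I (le_max_left t s) ≫ b = γ ≫ (cokerSES f).g := by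
      ext
      refine Eq.trans hy.symm ?_
      exact congrArg (LinearMap.range f.hom).mkQ (one_smul R y).symm
    rw [extRes_comp, extRes, Ext.mk₀_comp_mk₀, hγ, ← Ext.mk₀_comp_mk₀,
      Ext.comp_assoc _ _ _ (zero_add 0) (zero_add 1) (by lia), hS.comp_extClass, Ext.comp_zero]
  | succ j ih =>
    intro T hT t α
    obtain ⟨J, f, hJT, hJ, hf⟩ := exists_torsion_embedding I hT
    have hS := cokerSES_shortExact f hf
    obtain ⟨β, rfl⟩ := Ext.covariant_sequence_exact₁ _ hS α
      ((subsingleton_ext_of_injective _ J _).elim _ _) rfl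
    obtain ⟨s, h, hβ⟩ := ih (T := (cokerSES f).X₃)
      (hJT.of_surjective _ (LinearMap.range f.hom).mkQ_surjective) t β
    exact ⟨s, h, by rw [extRes_comp, hβ, Ext.zero_comp]⟩

open Abelian in
lemma IsLocalCohomology.of_quotient_torsion [IsNoetherianRing R] {I : Ideal R} {n : ℕ}
    {S : ShortComplex (ModuleCat.{0} R)}
    (hS : S.ShortExact) (hT : IsIdealTorsion I S.X₁) {H : Type} [AddCommGroup H] [Module R H]
    {ι : ∀ t, Abelian.Ext (powQuot I t) S.X₃ (n + 1) →ₗ[R] H}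
    (hι : IsLocalCohomology I (n + 1) S.X₃ ι) :
    ∃ ι', IsLocalCohomology I (n + 1) S.X₂ (H := H) ι' := by
  refine ⟨_, hι.transport
    (fun t => Abelian.Ext.postcompOfLinear (Ext.mk₀ S.g) R (powQuot I t) (add_zero _))
    (fun {s t} h α => (extRes_comp _ α _ (add_zero _)).symm) (fun t α h => ?_) (fun t β => ?_)⟩
  · obtain ⟨τ, rfl⟩ := Ext.covariant_sequence_exact₂ _ hS α h
    obtain ⟨s, hs, hτ⟩ := exists_extRes_powQuotMap_eq_zero I n hT t τ
    exact ⟨s, hs, by rw [extRes_comp, hτ, Ext.zero_comp]⟩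
  · obtain ⟨s, hs, hτ⟩ := exists_extRes_powQuotMap_eq_zero I (n + 1) hT t
      (β.comp hS.extClass rfl)
    rw [extRes_comp] at hτ
    obtain ⟨α, hα⟩ := Ext.covariant_sequence_exact₃ _ hS _ _ hτ
    exact ⟨s, hs, α, hα⟩

open Abelian in
lemma subsingleton_ext_of_iso {N X Y : ModuleCat.{0} R} (e : X ≅ Y) {i : ℕ}
    (h : Subsingleton (Abelian.Ext N X i)) : Subsingleton (Abelian.Ext N Y i) := by
  refine subsingleton_of_forall_eq 0 fun α => ?_
  have : (α.comp (Ext.mk₀ e.inv) (add_zero i)).comp (Ext.mk₀ e.hom) (add_zero i) = α := by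
    rw [Ext.comp_assoc _ _ _ (add_zero i) (add_zero 0) (by lia), Ext.mk₀_comp_mk₀, e.inv_hom_id,
      Ext.comp_mk₀_id]
  rw [← this, Subsingleton.elim (α.comp (Ext.mk₀ e.inv) (add_zero i)) 0, Ext.zero_comp]

open Abelian in
lemma subsingleton_ext_of_iso' {N X Y : ModuleCat.{0} R} (e : X ≅ Y) {i : ℕ}
    (h : Subsingleton (Abelian.Ext X N i)) : Subsingleton (Abelian.Ext Y N i) := by
  refine subsingleton_of_forall_eq 0 fun α => ?_
  have : extRes e.inv (extRes e.hom α) = α := by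
    rw [extRes_extRes, e.inv_hom_id, extRes, Ext.mk₀_id_comp]
  rw [← this, Subsingleton.elim (extRes e.hom α) 0, extRes_zero]

lemma nonempty_ext_zero_linearEquiv (N M : ModuleCat.{0} R) :
    Nonempty (Abelian.Ext N M 0 ≃ₗ[R] (N →ₗ[R] M)) :=
  ⟨Abelian.Ext.linearEquiv₀.trans ModuleCat.homLinearEquiv⟩

lemma subsingleton_ext_zero_iff (N M : ModuleCat.{0} R) :
    Subsingleton (Abelian.Ext N M 0) ↔ ∀ f : N →ₗ[R] M, f = 0 := by
  obtain ⟨e⟩ := nonempty_ext_zero_linearEquiv N M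
  rw [e.toEquiv.subsingleton_congr]
  exact ⟨fun h f => h.elim _ _, fun h => subsingleton_of_forall_eq 0 h⟩

lemma idealTorsion_eq_bot {I : Ideal R} {M : ModuleCat.{0} R}
    (h : ∀ t, Subsingleton (Abelian.Ext (powQuot I t) M 0)) : idealTorsion I M = ⊥ := by
  rw [eq_bot_iff]
  rintro x ⟨t, ht⟩
  have h1 := (subsingleton_ext_zero_iff _ _).1 (h t)
    (Submodule.liftQ (I ^ t) (LinearMap.toSpanSingleton R M x) ht)
  exact (one_smul R x).symm.trans congr($h1 (Ideal.Quotient.mk _ 1))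

lemma idealTorsion_quotient_eq_bot (I : Ideal R) [IsNoetherianRing R] (M : ModuleCat.{0} R) :
    idealTorsion I (M ⧸ idealTorsion I M) = ⊥ := by
  rw [eq_bot_iff]
  rintro x ⟨t, ht⟩
  obtain ⟨x, rfl⟩ := Submodule.Quotient.mk_surjective _ x
  have : IsNoetherian R (Submodule.span R {x}) :=
    isNoetherian_span_of_finite R (Set.finite_singleton x)
  have : IsNoetherian R ↥(I ^ t • Submodule.span R {x}) :=
    isNoetherian_of_le (t := Submodule.span R {x}) Submodule.smul_le_right
  obtain ⟨k, hk⟩ := ((isIdealTorsion_idealTorsion I M).of_injective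
    (Submodule.inclusion (show (I ^ t) • Submodule.span R {x} ≤ idealTorsion I M by
      rw [Submodule.smul_le]
      intro r hr y hy
      obtain ⟨a, rfl⟩ := Submodule.mem_span_singleton.1 hy
      rw [smul_comm]
      exact Submodule.smul_mem _ _ ((Submodule.Quotient.mk_eq_zero _).1 (ht r hr))))
    (Submodule.inclusion_injective _)).exists_pow_smul_eq_zero
  refine (Submodule.Quotient.mk_eq_zero _).2 ⟨k + t, fun r hr => ?_⟩
  rw [pow_add] at hr
  refine Submodule.mul_induction_on hr (fun a ha b hb => ?_) (fun a b ha hb => ?_)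
  · rw [mul_smul]
    exact congrArg Subtype.val (hk a ha ⟨b • x, Submodule.smul_mem_smul hb
      (Submodule.mem_span_singleton_self x)⟩)
  · rw [add_smul, ha, hb, add_zero]

open Abelian in
lemma IsLocalCohomology.lowest_zero [IsNoetherianRing R] {I : Ideal R} {M : ModuleCat.{0} R}
    {H : Type} [AddCommGroup H] [Module R H] {ι : ∀ t, Abelian.Ext (powQuot I t) M 0 →ₗ[R] H}
    (hι : IsLocalCohomology I 0 M ι) {N : ModuleCat.{0} R} (hN : IsIdealTorsion I N) :
    Nonempty (Abelian.Ext N M 0 ≃ₗ[R] (N →ₗ[R] H)) ∧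
      (Subsingleton (Abelian.Ext N M 1) → Subsingleton (Abelian.Ext N (ModuleCat.of R H) 1)) := by
  obtain ⟨ι', hι'⟩ := isLocalCohomology_zero I M
  obtain ⟨e⟩ := hι'.nonempty_linearEquiv hι
  have hbij : Function.Bijective (LinearMap.compRight (M := N) R (idealTorsion I M).subtype) := by
    refine ⟨fun f g h => LinearMap.ext fun x => Subtype.ext congr($h x), fun f => ?_⟩
    refine ⟨f.codRestrict _ fun x => ?_, rfl⟩
    obtain ⟨t, ht⟩ := hN x
    exact ⟨t, fun r hr => by rw [← map_smul, ht r hr, map_zero]⟩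
  obtain ⟨e'⟩ := nonempty_ext_zero_linearEquiv N M
  refine ⟨⟨e'.trans ((LinearEquiv.ofBijective _ hbij).symm.trans
    (LinearEquiv.congrRight e))⟩, fun h => ?_⟩
  refine subsingleton_ext_of_iso (X := ModuleCat.of R (idealTorsion I M)) e.toModuleIso ?_
  have hS := quotSES_shortExact (idealTorsion I M)
  have h0 : Subsingleton (Abelian.Ext N (ModuleCat.of R (M ⧸ idealTorsion I M)) 0) := by
    rw [subsingleton_ext_zero_iff]
    refine fun f => LinearMap.ext fun x => ?_
    obtain ⟨t, ht⟩ := hN x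
    have : f x ∈ idealTorsion I (M ⧸ idealTorsion I M) :=
      ⟨t, fun r hr => by rw [← map_smul, ht r hr, map_zero]⟩
    rwa [idealTorsion_quotient_eq_bot] at this
  refine subsingleton_of_forall_eq 0 fun α => ?_
  obtain ⟨β, rfl⟩ := Ext.covariant_sequence_exact₁ N hS α (h.elim _ _) rfl
  rw [h0.elim β 0, Ext.zero_comp]

open Abelian in
/-- The lowest nonvanishing local cohomology module represents `Ext` on torsion modules. -/
theorem IsLocalCohomology.lowest [IsNoetherianRing R] {I : Ideal R} (n : ℕ) :
    ∀ {M : ModuleCat.{0} R} (_ : ∀ i < n, ∀ t, Subsingleton (Abelian.Ext (powQuot I t) M i))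
    {H : Type} [AddCommGroup H] [Module R H] {ι : ∀ t, Abelian.Ext (powQuot I t) M n →ₗ[R] H}
    (_ : IsLocalCohomology I n M ι) {N : ModuleCat.{0} R} (_ : IsIdealTorsion I N),
    (∀ i < n, Subsingleton (Abelian.Ext N M i)) ∧
    Nonempty (Abelian.Ext N M n ≃ₗ[R] (N →ₗ[R] H)) ∧
      (Subsingleton (Abelian.Ext N M (n + 1)) →
        Subsingleton (Abelian.Ext N (ModuleCat.of R H) 1)) := by
  induction n with
  | zero =>
    intro M _ H _ _ ι hι N hN
    exact ⟨by simp, hι.lowest_zero hN⟩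
  | succ n ih =>
    intro M hM H _ _ ι hι N hN
    obtain ⟨J, f, hJ, hf⟩ := exists_local_embedding I (idealTorsion_eq_bot (hM 0 n.succ_pos))
    have hS := cokerSES_shortExact f hf
    have hQ := isIdealLocal_quotient I hJ
    obtain ⟨ι', hι'⟩ := hι.shift hS hQ
    have hb {N : ModuleCat.{0} R} (hN : IsIdealTorsion I N) (i : ℕ) :=
      bijective_comp_extClass hS N i (hQ N hN i) (hQ N hN (i + 1))
    obtain ⟨h1, ⟨e⟩, h3⟩ := ih (M := (cokerSES f).X₃) (fun i hi t => by
      have := hM (i + 1) (by lia) t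
      exact (hb (isIdealTorsion_powQuot I t) i).1.subsingleton) hι' hN
    refine ⟨fun i hi => ?_, ⟨(LinearEquiv.ofBijective _ (hb hN n)).symm.trans e⟩, fun h => ?_⟩
    · cases i with
      | zero =>
        have h0 := (subsingleton_ext_zero_iff _ _).1 (hQ N hN 0)
        refine (subsingleton_ext_zero_iff _ _).2 fun g => LinearMap.ext fun x => hf ?_
        rw [LinearMap.zero_apply, map_zero]
        exact congr($(h0 (f.hom ∘ₗ g)) x)
      | succ i =>
        have := h1 i (by lia)
        exact (hb hN i).2.subsingleton
    · exact h3 ((hb hN (n + 1)).1.subsingleton)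

lemma IsAdicComplete.exists_solution (I : Ideal R) [IsAdicComplete I R] {x : R} (hx : x ∈ I)
    (g : ℕ → R) : ∃ f : ℕ → R, ∀ n, x * f (n + 1) - f n = g n := by
  have key (n : ℕ) : ∃ l : R, ∀ k, ∑ j ∈ Finset.range k, x ^ j * g (n + j) - l ∈ I ^ k := by
    obtain ⟨l, hl⟩ := IsPrecomplete.prec (I := I) (M := R) inferInstance
      (f := fun k => ∑ j ∈ Finset.range k, x ^ j * g (n + j)) (by
        intro k k' hkk'
        rw [SModEq.comm, SModEq.sub_mem, smul_eq_mul, Ideal.mul_top,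
          ← Finset.sum_Ico_eq_sub _ hkk']
        refine Ideal.sum_mem _ fun j hj => Ideal.mul_mem_right _ _ ?_
        exact Ideal.pow_le_pow_right (Finset.mem_Ico.1 hj).1 (Ideal.pow_mem_pow hx j))
    refine ⟨l, fun k => ?_⟩
    simpa [SModEq.sub_mem] using hl k
  choose l hl using key
  refine ⟨fun n => - l n, fun n => ?_⟩
  refine sub_eq_zero.1 (IsHausdorff.haus (I := I) (M := R) inferInstance _ fun k => ?_)
  rw [SModEq.sub_mem, smul_eq_mul, Ideal.mul_top, sub_zero]
  have h1 := Ideal.pow_le_pow_right (I := I) k.le_succ (hl n (k + 1))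
  have h2 := Ideal.mul_mem_left _ x (hl (n + 1) k)
  rw [Finset.sum_range_succ'] at h1
  convert Ideal.sub_mem _ h2 h1 using 1
  rw [mul_sub, Finset.mul_sum]
  have : ∀ j, x ^ (j + 1) * g (n + (j + 1)) = x * (x ^ j * g (n + 1 + j)) := fun j => by
    rw [pow_succ', mul_assoc, add_right_comm, add_assoc]
  simp only [this, pow_zero, one_mul, add_zero]
  ring

lemma IsAdicComplete.exists_solution_module (I : Ideal R) [IsAdicComplete I R] {x : R}
    (hx : x ∈ I) {M : Type} [AddCommGroup M] [Module R M] [Module.Finite R M] (g : ℕ → M) :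
    ∃ f : ℕ → M, ∀ n, x • f (n + 1) - f n = g n := by
  obtain ⟨m, φ, hφ⟩ := Module.Finite.exists_fin' R M
  choose g' hg' using fun n => hφ (g n)
  choose f hf using fun i : Fin m => IsAdicComplete.exists_solution I hx fun n => g' n i
  refine ⟨fun n => φ fun i => f i n, fun n => ?_⟩
  rw [← map_smul, ← map_sub, ← hg']
  exact congrArg φ (funext fun i => hf i n)

open Polynomial in
/-- The free resolution `0 → R[X]^(L) → R[X]^(L) → (R_x)^(L) → 0` of a free `R_x`-module. -/
abbrev awaySES (x : R) (L : Type) : ShortComplex (ModuleCat.{0} R) where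
  X₁ := ModuleCat.of R (L →₀ R[X])
  X₂ := ModuleCat.of R (L →₀ R[X])
  X₃ := ModuleCat.of R (L →₀ Localization.Away x)
  f := ModuleCat.ofHom (Finsupp.mapRange.linearMap (LinearMap.mulLeft R (C x * X - 1)))
  g := ModuleCat.ofHom (Finsupp.mapRange.linearMap
    ((Localization.awayEquivAdjoin x).symm.toLinearMap ∘ₗ
      (Ideal.Quotient.mkₐ R (Ideal.span {C x * X - 1})).toLinearMap))
  zero := by
    refine ModuleCat.hom_ext ?_
    rw [ModuleCat.hom_comp, ModuleCat.hom_ofHom, ModuleCat.hom_ofHom,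
      ← Finsupp.mapRange.linearMap_comp]
    have : ((Localization.awayEquivAdjoin x).symm.toLinearMap ∘ₗ
      (Ideal.Quotient.mkₐ R (Ideal.span {C x * X - 1})).toLinearMap) ∘ₗ
        (LinearMap.mulLeft R (C x * X - 1)) = 0 := by
      refine LinearMap.ext fun p => ?_
      have : Ideal.Quotient.mkₐ R (Ideal.span {C x * X - 1}) ((C x * X - 1) * p) = 0 :=
        Ideal.Quotient.eq_zero_iff_mem.2
          (Ideal.mul_mem_right _ _ (Ideal.mem_span_singleton_self _))
      exact (congrArg (Localization.awayEquivAdjoin x).symm this).trans (map_zero _)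
    rw [this]
    ext
    simp

open Polynomial in
lemma awaySES_shortExact (x : R) (L : Type) : (awaySES x L).ShortExact := by
  have h1 : Function.Injective (LinearMap.mulLeft R (C x * X - 1)) := by
    have : C x * X - 1 ∈ nonZeroDivisors R[X] := by
      refine Polynomial.mem_nonZeroDivisors_iff.2 fun a ha => ?_
      have := congrArg (fun p => coeff p 0) ha
      simpa using this
    refine (injective_iff_map_eq_zero _).2 fun p hp => ?_
    exact (mul_left_mem_nonZeroDivisors_eq_zero_iff this).1 hp
  have h2 : Function.Surjective ((Localization.awayEquivAdjoin x).symm.toLinearMap ∘ₗ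
      (Ideal.Quotient.mkₐ R (Ideal.span {C x * X - 1})).toLinearMap) :=
    (Localization.awayEquivAdjoin x).symm.surjective.comp Ideal.Quotient.mk_surjective
  refine ModuleCat.shortComplex_shortExact _ ?_ (Finsupp.mapRange_injective _ (map_zero _) h1)
    (Finsupp.mapRange_surjective _ (map_zero _) h2)
  refine LinearMap.exact_iff.2 ?_
  refine (Finsupp.ker_mapRange _ _).trans (.trans ?_
    (Finsupp.range_mapRange_linearMap _ (LinearMap.ker_eq_bot.2 h1) _).symm)
  congr 1
  funext _
  refine Submodule.ext fun p => ?_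
  rw [LinearMap.mem_ker, LinearMap.mem_range]
  refine (EmbeddingLike.map_eq_zero_iff (f := (Localization.awayEquivAdjoin x).symm)).trans
    (Ideal.Quotient.eq_zero_iff_mem.trans ?_)
  rw [Ideal.mem_span_singleton']
  exact exists_congr fun a => by rw [mul_comm, LinearMap.mulLeft_apply]

/-- Multiplication by `x` is bijective on `L`. -/
def IsSMulBijective (x : R) (L : Type) [AddCommGroup L] [Module R L] : Prop :=
  Function.Bijective fun l : L => x • l

lemma IsSMulBijective.isUnit {x : R} {L : Type} [AddCommGroup L] [Module R L]
    (h : IsSMulBijective x L) (s : Submonoid.powers x) :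
    IsUnit (algebraMap R (Module.End R L) s) := by
  obtain ⟨_, n, rfl⟩ := s
  rw [map_pow]
  exact ((Module.End.isUnit_iff (algebraMap R (Module.End R L) x)).2 h).pow n

lemma isSMulBijective_away (x : R) (L : Type) :
    IsSMulBijective x (L →₀ Localization.Away x) := by
  have hx := IsLocalization.Away.algebraMap_isUnit (S := Localization.Away x) x
  have h (v : Localization.Away x) : x • v = algebraMap R _ x * v := Algebra.smul_def _ _
  constructor
  · intro f g hfg
    ext l
    have := DFunLike.congr_fun hfg l
    simp only [Finsupp.smul_apply, h] at this
    exact hx.mul_left_cancel this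
  · intro f
    refine ⟨(↑hx.unit⁻¹ : Localization.Away x) • f, ?_⟩
    ext l
    simp only [Finsupp.smul_apply, h, smul_eq_mul]
    rw [← mul_assoc, IsUnit.mul_val_inv, one_mul]

lemma IsSMulBijective.exists_surjective {x : R} {L : Type} [AddCommGroup L] [Module R L]
    (h : IsSMulBijective x L) :
    ∃ π : (L →₀ Localization.Away x) →ₗ[R] L, Function.Surjective π := by
  refine ⟨Finsupp.lsum R fun l => IsLocalizedModule.lift (Submonoid.powers x)
    (Algebra.linearMap R (Localization.Away x)) (LinearMap.toSpanSingleton R L l) h.isUnit,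
    fun l => ⟨Finsupp.single l (Algebra.linearMap R (Localization.Away x) 1), ?_⟩⟩
  rw [Finsupp.lsum_single, IsLocalizedModule.lift_apply, LinearMap.toSpanSingleton_apply, one_smul]

lemma IsSMulBijective.ker {x : R} {V L : Type} [AddCommGroup L] [Module R L] [AddCommGroup V]
    [Module R V] (hV : IsSMulBijective x V) (hL : IsSMulBijective x L) (π : V →ₗ[R] L) :
    IsSMulBijective x (LinearMap.ker π) := by
  constructor
  · intro a b hab
    exact Subtype.ext (hV.1 congr(($hab).val))
  · intro a
    obtain ⟨v, hv⟩ := hV.2 a.1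
    refine ⟨⟨v, hL.1 ?_⟩, Subtype.ext hv⟩
    simpa using (map_smul π x v).symm.trans ((congrArg π hv).trans a.2)

lemma IsSMulBijective.linearMap_eq_zero [IsLocalRing R] [IsNoetherianRing R] {x : R} (hx : x ∈ IsLocalRing.maximalIdeal R) {L M : Type}
    [AddCommGroup L] [Module R L] [AddCommGroup M] [Module R M] [Module.Finite R M]
    (hL : IsSMulBijective x L) (f : L →ₗ[R] M) : f = 0 := by
  refine LinearMap.ext fun l => ?_
  have h (k : ℕ) (l : L) : f l ∈ IsLocalRing.maximalIdeal R ^ k • (⊤ : Submodule R M) := by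
    induction k generalizing l with
    | zero => simp
    | succ k ih =>
      obtain ⟨l', rfl⟩ := hL.2 l
      simp only [map_smul]
      rw [pow_succ', Submodule.mul_smul]
      exact Submodule.smul_mem_smul hx (ih l')
  have := Ideal.iInf_pow_smul_eq_bot_of_isLocalRing (M := M) (IsLocalRing.maximalIdeal R)
    (Ideal.IsPrime.ne_top inferInstance)
  rw [LinearMap.zero_apply, ← Submodule.mem_bot (R := R), ← this]
  exact Submodule.mem_iInf _ |>.2 fun k => h k l

section Complete

variable [IsLocalRing R] [IsAdicComplete (IsLocalRing.maximalIdeal R) R]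

open Abelian in
lemma subsingleton_ext_away {x : R} (hx : x ∈ IsLocalRing.maximalIdeal R) {M : ModuleCat.{0} R}
    [Module.Finite R M] (L : Type) (i : ℕ) :
    Subsingleton (Abelian.Ext (ModuleCat.of R (L →₀ Localization.Away x)) M (i + 1)) := by
  have hS := awaySES_shortExact x L
  have hp : Projective (awaySES x L).X₁ :=
    (inferInstance : Projective (ModuleCat.of R (L →₀ Polynomial R)))
  refine subsingleton_of_forall_eq 0 fun α => ?_
  obtain ⟨β, rfl⟩ := Ext.contravariant_sequence_exact₃ hS M α
    (Ext.eq_zero_of_projective (P := (awaySES x L).X₁) _) (add_comm 1 i)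
  cases i with
  | succ i => rw [Ext.eq_zero_of_projective (P := (awaySES x L).X₁) β, Ext.comp_zero]
  | zero =>
    obtain ⟨g, rfl⟩ := (Ext.mk₀_bijective _ _).2 β
    choose f hf using fun l => IsAdicComplete.exists_solution_module _ hx
      fun n => g.hom (Finsupp.single l (Polynomial.X ^ n))
    let F : (L →₀ Polynomial R) →ₗ[R] M :=
      Finsupp.lsum R fun l => (Polynomial.basisMonomials R).constr R (f l)
    have hF (l n) : F (Finsupp.single l (Polynomial.X ^ n)) = f l n := by
      have := (Polynomial.basisMonomials R).constr_basis R (f l) n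
      simp only [Polynomial.coe_basisMonomials, Polynomial.monomial_one_right_eq_X_pow] at this
      rw [Finsupp.lsum_single, this]
    have : g = (awaySES x L).f ≫ ModuleCat.ofHom F := by
      refine ModuleCat.hom_ext (Finsupp.lhom_ext' fun l =>
        (Polynomial.basisMonomials R).ext fun n => ?_)
      simp only [Polynomial.coe_basisMonomials, Polynomial.monomial_one_right_eq_X_pow]
      refine (hf l n).symm.trans ?_
      rw [← hF, ← hF, ← map_smul, ← map_sub]
      refine congrArg F ?_
      refine .trans ?_ (Finsupp.mapRange_single (hf := map_zero _)).symm
      rw [Finsupp.smul_single, ← Finsupp.single_sub, LinearMap.mulLeft_apply,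
        Polynomial.smul_eq_C_mul]
      ring_nf
    rw [this, ← Ext.mk₀_comp_mk₀, ← Ext.comp_assoc _ _ _ (add_comm 1 0) (add_zero 0) (by lia)]
    rw [hS.extClass_comp, Ext.zero_comp]

open Abelian in
/-- A finite module over a complete local ring receives no extensions from modules on which an
element of the maximal ideal acts bijectively. -/
theorem IsSMulBijective.subsingleton_ext [IsNoetherianRing R] {x : R} (hx : x ∈ IsLocalRing.maximalIdeal R)
    {M : ModuleCat.{0} R} [Module.Finite R M] (i : ℕ) :
    ∀ {L : ModuleCat.{0} R}, IsSMulBijective x L → Subsingleton (Abelian.Ext L M i) := by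
  induction i with
  | zero =>
    intro L hL
    exact (subsingleton_ext_zero_iff _ _).2 (hL.linearMap_eq_zero hx)
  | succ i ih =>
    intro L hL
    obtain ⟨π, hπ⟩ := hL.exists_surjective
    have hS := LinearMap.shortExact_shortComplexKer hπ
    have hK := ih (L := π.shortComplexKer.X₁) ((isSMulBijective_away x L).ker hL π)
    refine subsingleton_of_forall_eq 0 fun α => ?_
    obtain ⟨β, rfl⟩ := Ext.contravariant_sequence_exact₃ hS M α
      ((subsingleton_ext_away hx L i).elim _ _) (add_comm 1 i)
    rw [hK.elim β 0, Ext.comp_zero]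

end Complete

lemma isSMulBijective_quotient [IsNoetherianRing R] (x : R) (J : Type) [AddCommGroup J]
    [Module R J] [Module.Injective R J] :
    IsSMulBijective x (J ⧸ idealTorsion (Ideal.span {x}) (ModuleCat.of R J)) := by
  have hmem (y : J) : y ∈ idealTorsion (Ideal.span {x}) (ModuleCat.of R J) ↔
      ∃ t : ℕ, x ^ t • y = 0 := by
    refine exists_congr fun t => ⟨fun h => ?_, fun h r hr => ?_⟩
    · exact h _ (Ideal.pow_mem_pow (Ideal.mem_span_singleton_self x) t)
    · rw [Ideal.span_singleton_pow, Ideal.mem_span_singleton'] at hr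
      obtain ⟨a, rfl⟩ := hr
      rw [mul_smul, h, smul_zero]
  constructor
  · intro a b hab
    obtain ⟨a, rfl⟩ := Submodule.mkQ_surjective _ a
    obtain ⟨b, rfl⟩ := Submodule.mkQ_surjective _ b
    simp only [← map_smul] at hab
    rw [← sub_eq_zero, ← map_sub] at hab ⊢
    rw [← smul_sub] at hab
    obtain ⟨t, ht⟩ := (hmem _).1 ((Submodule.Quotient.mk_eq_zero _).1 hab)
    refine (Submodule.Quotient.mk_eq_zero _).2 ((hmem _).2 ⟨t + 1, ?_⟩)
    rw [pow_succ, mul_smul]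
    exact ht
  · intro y
    obtain ⟨y, rfl⟩ := Submodule.mkQ_surjective _ y
    obtain ⟨n, hn⟩ := monotone_stabilizes_iff_noetherian.2 (inferInstance : IsNoetherian R R)
      ⟨fun n => LinearMap.ker (LinearMap.mulLeft R (x ^ n)),
        monotone_nat_of_le_succ fun n r hr => by
          rw [LinearMap.mem_ker, LinearMap.mulLeft_apply] at hr ⊢
          rw [pow_succ', mul_assoc, hr, mul_zero]⟩
    have hle : LinearMap.ker (LinearMap.mulLeft R (x ^ (n + 1))) ≤
        LinearMap.ker (LinearMap.toSpanSingleton R J (x ^ n • y)) := by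
      refine (hn (n + 1) n.le_succ).symm.le.trans fun r hr => ?_
      have hr : x ^ n * r = 0 := hr
      rw [LinearMap.mem_ker, LinearMap.toSpanSingleton_apply, smul_smul, mul_comm, hr, zero_smul]
    obtain ⟨h, hh⟩ := Module.Injective.out (Q := J)
      ((LinearMap.ker (LinearMap.mulLeft R (x ^ (n + 1)))).liftQ _ le_rfl)
      (LinearMap.ker_eq_bot.1 (Submodule.ker_liftQ_eq_bot _ _ _ le_rfl))
      (Submodule.liftQ _ _ hle)
    have h1 := hh (Submodule.mkQ _ 1)
    rw [Submodule.mkQ_apply, Submodule.liftQ_apply, Submodule.liftQ_apply,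
      LinearMap.mulLeft_apply, LinearMap.toSpanSingleton_apply, one_smul,
      ← smul_eq_mul, map_smul, pow_succ, mul_smul] at h1
    refine ⟨Submodule.mkQ _ (h 1), ?_⟩
    simp only [← LinearMap.map_smul (Submodule.mkQ _)]
    refine (Submodule.Quotient.eq _).2 ((hmem _).2 ⟨n, ?_⟩)
    rw [smul_sub, ← h1, sub_self]

/-- The short complex `Γ_𝔞 J / Γ_𝔟 Γ_𝔞 J ⟶ J / Γ_{𝔞 + 𝔟} J ⟶ J / Γ_𝔞 J`. -/
abbrev supSES (a b : Ideal R) (J : ModuleCat.{0} R) : ShortComplex (ModuleCat.{0} R) where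
  X₁ := ModuleCat.of R (idealTorsion a J ⧸ idealTorsion b (ModuleCat.of R (idealTorsion a J)))
  X₂ := ModuleCat.of R (J ⧸ idealTorsion (a ⊔ b) J)
  X₃ := ModuleCat.of R (J ⧸ idealTorsion a J)
  f := ModuleCat.ofHom (Submodule.mapQ _ _ (idealTorsion a J).subtype (by
    rintro ⟨y, s, hs⟩ ⟨t, ht⟩
    refine ⟨s + t, fun r hr => ?_⟩
    obtain ⟨u, hu, v, hv, rfl⟩ := Submodule.mem_sup.1 (Ideal.sup_pow_add_le_pow_sup_pow hr)
    have := congrArg Subtype.val (ht v hv)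
    rw [add_smul]
    exact (congrArg₂ (· + ·) (hs u hu) this).trans (add_zero 0)))
  g := ModuleCat.ofHom (Submodule.factor (by
    rintro y ⟨s, hs⟩
    exact ⟨s, fun r hr => hs r (Ideal.pow_right_mono le_sup_left s hr)⟩))
  zero := by
    refine ModuleCat.hom_ext (Submodule.linearMap_qext _ (LinearMap.ext fun y => ?_))
    exact (Submodule.Quotient.mk_eq_zero _).2 y.2

lemma supSES_shortExact (a b : Ideal R) (J : ModuleCat.{0} R) : (supSES a b J).ShortExact := by
  refine ModuleCat.shortComplex_shortExact _ ?_ ?_ fun y => ?_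
  · intro y
    obtain ⟨y, rfl⟩ := Submodule.mkQ_surjective _ y
    constructor
    · intro hy
      exact ⟨Submodule.mkQ _ ⟨y, (Submodule.Quotient.mk_eq_zero _).1 hy⟩, rfl⟩
    · rintro ⟨z, hz⟩
      rw [← hz]
      exact congr(($((supSES a b J).zero)).hom z)
  · refine (injective_iff_map_eq_zero (supSES a b J).f.hom).2 fun y hy => ?_
    obtain ⟨y, rfl⟩ := Submodule.mkQ_surjective _ y
    obtain ⟨t, ht⟩ := (Submodule.Quotient.mk_eq_zero _).1 hy
    exact (Submodule.Quotient.mk_eq_zero _).2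
      ⟨t, fun r hr => Subtype.ext (ht r (Ideal.pow_right_mono le_sup_right t hr))⟩
  · obtain ⟨y, rfl⟩ := Submodule.mkQ_surjective _ y
    exact ⟨Submodule.mkQ _ y, rfl⟩

section Complete

variable [IsLocalRing R] [IsNoetherianRing R] [IsAdicComplete (IsLocalRing.maximalIdeal R) R]

open Abelian in
/-- A finite module over a complete local ring receives no extensions from `J / Γ_𝔞 J`,
for `J` injective. -/
theorem subsingleton_ext_quotient_idealTorsion {M : ModuleCat.{0} R} [Module.Finite R M]
    {a : Ideal R} (ha : a ≤ IsLocalRing.maximalIdeal R) {J : ModuleCat.{0} R} (hJ : Injective J)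
    (i : ℕ) : Subsingleton (Abelian.Ext (ModuleCat.of R (J ⧸ idealTorsion a J)) M i) := by
  induction a, IsNoetherian.noetherian a using Submodule.fg_induction generalizing J i with
  | singleton x =>
    have : Module.Injective R J := Module.Injective.of_category hJ
    exact (isSMulBijective_quotient x J).subsingleton_ext
      (ha (Ideal.mem_span_singleton_self x)) (L := ModuleCat.of R (J ⧸ _)) i
  | sup a b _ _ iha ihb =>
    have hS := supSES_shortExact a b J
    have h1 := ihb (le_sup_right.trans ha) (injective_of_idealTorsion a hJ) i
    have h3 := iha (le_sup_left.trans ha) hJ i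
    refine subsingleton_of_forall_eq 0 fun α => ?_
    obtain ⟨β, rfl⟩ := Ext.contravariant_sequence_exact₂ hS M α (h1.elim _ _)
    rw [h3.elim β 0, Ext.comp_zero]

end Complete

open Abelian in
lemma subsingleton_ext_X₂ {S : ShortComplex (ModuleCat.{0} R)} (hS : S.ShortExact)
    (N : ModuleCat.{0} R) {i : ℕ} (h1 : Subsingleton (Abelian.Ext S.X₁ N i))
    (h3 : Subsingleton (Abelian.Ext S.X₃ N i)) : Subsingleton (Abelian.Ext S.X₂ N i) := by
  refine subsingleton_of_forall_eq 0 fun α => ?_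
  obtain ⟨β, rfl⟩ := Ext.contravariant_sequence_exact₂ hS N α (h1.elim _ _)
  rw [h3.elim β 0, Ext.comp_zero]

open Abelian in
/-- Vanishing of `Ext` of finite modules can be checked on the primes of the support. -/
lemma subsingleton_ext_of_forall_prime [IsNoetherianRing R] {M : ModuleCat.{0} R} {i : ℕ}
    {N : ModuleCat.{0} R} [Module.Finite R N]
    (h : ∀ q : Ideal R, q.IsPrime → Module.annihilator R N ≤ q →
      Subsingleton (Abelian.Ext (ModuleCat.of R (R ⧸ q)) M i)) :
    Subsingleton (Abelian.Ext N M i) := by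
  refine IsNoetherianRing.induction_on_isQuotientEquivQuotientPrime R
    (M := N) inferInstance
    (motive := fun N _ _ _ => (∀ q : Ideal R, q.IsPrime → Module.annihilator R N ≤ q →
      Subsingleton (Abelian.Ext (ModuleCat.of R (R ⧸ q)) M i)) →
        Subsingleton (Abelian.Ext (ModuleCat.of R N) M i)) ?_ ?_ ?_ h
  · intro N _ _ _ _ _
    have h0 : (𝟙 (ModuleCat.of R N)) = 0 := ModuleCat.hom_ext (Subsingleton.elim _ _)
    refine subsingleton_of_forall_eq 0 fun α => ?_
    rw [← Ext.mk₀_id_comp α, h0, Ext.mk₀_zero, Ext.zero_comp]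
  · intro N _ _ _ p e h
    refine subsingleton_ext_of_iso' e.symm.toModuleIso (h p.1 p.2 ?_)
    rw [e.annihilator_eq, Ideal.annihilator_quotient]
  · intro N₁ _ _ _ N₂ _ _ _ N₃ _ _ _ f g hf hg hfg h₁ h₃ h
    have hS := ModuleCat.shortComplex_shortExact
      (ModuleCat.shortComplexOfCompEqZero f g hfg.linearMap_comp_eq_zero) hfg hf hg
    exact subsingleton_ext_X₂ hS M
      (h₁ fun q hq hle => h q hq ((f.annihilator_le_of_injective hf).trans hle))
      (h₃ fun q hq hle => h q hq ((g.annihilator_le_of_surjective hg).trans hle))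

lemma ringKrullDim_quotient_succ_le_of_lt {p q : Ideal R} [p.IsPrime] (h : p < q) :
    ringKrullDim (R ⧸ q) + 1 ≤ ringKrullDim (R ⧸ p) := by
  obtain ⟨x, hx, hxp⟩ := SetLike.exists_of_lt h
  refine ringKrullDim_succ_le_of_surjective (Ideal.Quotient.factor h.le)
    (Ideal.Quotient.factor_surjective h.le) (r := Ideal.Quotient.mk p x) ?_ ?_
  · exact mem_nonZeroDivisors_of_ne_zero fun h0 => hxp (Ideal.Quotient.eq_zero_iff_mem.1 h0)
  · exact Ideal.Quotient.eq_zero_iff_mem.2 hx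

open Abelian in
/-- Vanishing of `Ext` into a finite module `M` outside a range determined by the degrees in
which `Ext` from the residue field lives. -/
theorem subsingleton_ext_quotient_prime [IsNoetherianRing R] [IsLocalRing R]
    {M : ModuleCat.{0} R} [Module.Finite R M] {d : ℕ}
    (hM : ∀ i ≠ d, Subsingleton (Abelian.Ext
      (ModuleCat.of R (IsLocalRing.ResidueField R)) M i))
    (p : Ideal R) (hp : p.IsPrime) (i : ℕ)
    (hi : d < i ∨ (i : WithBot ℕ∞) + ringKrullDim (R ⧸ p) < d) :
    Subsingleton (Abelian.Ext (ModuleCat.of R (R ⧸ p)) M i) := by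
  induction p using IsNoetherian.induction generalizing i with
  | hgt p ih =>
  rcases (IsLocalRing.le_maximalIdeal hp.ne_top).eq_or_lt with rfl | hlt
  · refine hM i ?_
    rintro rfl
    rcases hi with hi | hi
    · exact hi.false
    · refine hi.not_ge (le_add_of_nonneg_right ?_)
      exact ringKrullDim_nonneg_of_nontrivial
  obtain ⟨x, hx, hxp⟩ := SetLike.exists_of_lt hlt
  let f : ModuleCat.of R (R ⧸ p) ⟶ ModuleCat.of R (R ⧸ p) := x • 𝟙 _
  have hf : Function.Injective f.hom := by
    refine (injective_iff_map_eq_zero _).2 fun y hy => ?_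
    obtain ⟨y, rfl⟩ := Ideal.Quotient.mk_surjective y
    have hy : Ideal.Quotient.mk p (x * y) = 0 := hy
    rw [Ideal.Quotient.eq_zero_iff_mem] at hy ⊢
    exact (hp.mem_or_mem hy).resolve_left hxp
  have hS := cokerSES_shortExact f hf
  have : Subsingleton (Abelian.Ext (cokerSES f).X₃ M (i + 1)) := by
    refine subsingleton_ext_of_forall_prime fun q hq hle => ?_
    have hpq : p < q := by
      refine lt_of_le_of_ne (le_trans ?_ hle) ?_
      · refine (Ideal.annihilator_quotient (I := p)).ge.trans ?_
        exact (Submodule.mkQ _).annihilator_le_of_surjective (Submodule.mkQ_surjective _)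
      · rintro rfl
        refine hxp (hle (Module.mem_annihilator.2 fun y => ?_))
        obtain ⟨y, rfl⟩ := Submodule.mkQ_surjective _ y
        exact (Submodule.Quotient.mk_eq_zero _).2 ⟨y, rfl⟩
    refine ih q hpq hq (i + 1) (hi.imp (by lia) fun hi => lt_of_le_of_lt ?_ hi)
    push_cast
    rw [add_assoc, add_comm 1]
    gcongr
    exact ringKrullDim_quotient_succ_le_of_lt hpq
  have : Module.Finite R (Abelian.Ext (ModuleCat.of R (R ⧸ p)) M i) :=
    ModuleCat.finite_ext R _ _ i
  rw [← Submodule.subsingleton_iff R, ← subsingleton_iff_bot_eq_top, eq_comm]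
  refine Submodule.eq_bot_of_le_smul_of_le_jacobson_bot (IsLocalRing.maximalIdeal R) _
    Module.Finite.fg_top (fun α _ => ?_) (IsLocalRing.maximalIdeal_le_jacobson _)
  obtain ⟨β, rfl⟩ := Ext.contravariant_sequence_exact₁ hS M α (add_comm 1 i)
    (Subsingleton.elim _ _)
  have := Submodule.smul_mem_smul (N := ⊤) hx (Submodule.mem_top (R := R) (x := β))
  rw [smul_eq_extRes] at this
  exact this

open Abelian in
/-- A form of Baer's criterion in higher degrees. -/
lemma subsingleton_ext_of_forall_ideal (n : ℕ) {M : ModuleCat.{0} R}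
    (h : ∀ a : Ideal R, Subsingleton (Abelian.Ext (ModuleCat.of R (R ⧸ a)) M (n + 1)))
    (N : ModuleCat.{0} R) : Subsingleton (Abelian.Ext N M (n + 1)) := by
  induction n generalizing M with
  | zero =>
    have : Module.Injective R M := by
      refine Module.Baer.injective fun a g => ?_
      have hS := quotSES_shortExact (M := ModuleCat.of R R) a
      obtain ⟨β, hβ⟩ := Ext.contravariant_sequence_exact₁ hS M
        (Ext.mk₀ (X := ModuleCat.of R a) (ModuleCat.ofHom g)) (add_comm 1 0)
        ((h a).elim _ _)
      obtain ⟨g', rfl⟩ := (Ext.mk₀_bijective _ _).2 β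
      rw [Ext.mk₀_comp_mk₀] at hβ
      have := (Ext.mk₀_bijective _ _).1 hβ
      exact ⟨g'.hom, fun y hy => congr(($this).hom ⟨y, hy⟩)⟩
    have : Injective M := Module.injective_object_of_injective_module R M
    exact subsingleton_ext_of_injective N M 0
  | succ n ih =>
    obtain ⟨J, f, hJ, hf⟩ := exists_injective_embedding M
    have hS := cokerSES_shortExact f hf
    have hb (N : ModuleCat.{0} R) := bijective_comp_extClass hS N (n + 1)
      (subsingleton_ext_of_injective N J n) (subsingleton_ext_of_injective N J (n + 1))
    have := ih (M := (cokerSES f).X₃) fun a => (hb _).1.subsingleton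
    exact (hb N).2.subsingleton

lemma ringKrullDim_quotient_add_le_of_isRegular [IsNoetherianRing R] [IsLocalRing R]
    {rs : List R} (hrs : RingTheory.Sequence.IsRegular R rs) {q : Ideal R}
    (hq : ∀ r ∈ rs, r ∈ q) : ringKrullDim (R ⧸ q) + rs.length ≤ ringKrullDim R := by
  rw [← ringKrullDim_add_length_eq_ringKrullDim_of_isRegular rs hrs]
  gcongr
  have h : Ideal.ofList rs ≤ q := Ideal.span_le.2 hq
  exact ringKrullDim_le_of_surjective (Ideal.Quotient.factor h) (Ideal.Quotient.factor_surjective h)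

open Abelian in
lemma nonempty_ext_linearEquiv_of_iso {X Y : ModuleCat.{0} R} (e : X ≅ Y) (N : ModuleCat.{0} R)
    (i : ℕ) : Nonempty (Abelian.Ext Y N i ≃ₗ[R] Abelian.Ext X N i) := by
  refine ⟨LinearEquiv.ofLinearMap (Ext.precompOfLinear (Ext.mk₀ e.hom) R N (zero_add i))
    (Ext.precompOfLinear (Ext.mk₀ e.inv) R N (zero_add i)) ?_ ?_⟩
  · refine LinearMap.ext fun α => ?_
    refine (extRes_extRes e.hom e.inv α).trans ?_
    rw [e.hom_inv_id, extRes, Ext.mk₀_id_comp, LinearMap.id_apply]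
  · refine LinearMap.ext fun α => ?_
    refine (extRes_extRes e.inv e.hom α).trans ?_
    rw [e.inv_hom_id, extRes, Ext.mk₀_id_comp, LinearMap.id_apply]

open Abelian in
lemma bijective_extRes_f {S : ShortComplex (ModuleCat.{0} R)} (hS : S.ShortExact)
    (N : ModuleCat.{0} R) (i : ℕ) (h : Subsingleton (Abelian.Ext S.X₃ N i))
    (h' : Subsingleton (Abelian.Ext S.X₃ N (i + 1))) :
    Function.Bijective (Ext.precompOfLinear (Ext.mk₀ S.f) R N (zero_add i)) := by
  refine ⟨(injective_iff_map_eq_zero _).2 fun α hα => ?_, fun α => ?_⟩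
  · obtain ⟨β, rfl⟩ := Ext.contravariant_sequence_exact₂ hS N α hα
    rw [h.elim β 0, Ext.comp_zero]
  · exact Ext.contravariant_sequence_exact₁ hS N α (add_comm 1 i) (h'.elim _ _)

open Abelian in
lemma bijective_extRes_g {S : ShortComplex (ModuleCat.{0} R)} (hS : S.ShortExact)
    (N : ModuleCat.{0} R) (i : ℕ) (h : ∀ j ≤ i, Subsingleton (Abelian.Ext S.X₁ N j)) :
    Function.Bijective (Ext.precompOfLinear (Ext.mk₀ S.g) R N (zero_add i)) := by
  refine ⟨(injective_iff_map_eq_zero _).2 fun α hα => ?_, fun α => ?_⟩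
  · cases i with
    | zero =>
      obtain ⟨b, rfl⟩ := (Ext.mk₀_bijective _ _).2 α
      have hα : (Ext.mk₀ S.g).comp (Ext.mk₀ b) (zero_add 0) = 0 := hα
      rw [Ext.mk₀_comp_mk₀, ← Ext.mk₀_zero] at hα
      have := hS.epi_g
      rw [Limits.zero_of_epi_comp _ ((Ext.mk₀_bijective _ _).1 hα), Ext.mk₀_zero]
    | succ i =>
      obtain ⟨β, rfl⟩ := Ext.contravariant_sequence_exact₃ hS N α hα (add_comm 1 i)
      rw [(h i i.le_succ).elim β 0, Ext.comp_zero]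
  · exact Ext.contravariant_sequence_exact₂ hS N α ((h i le_rfl).elim _ _)

lemma IsLocalCohomology.congr {I : Ideal R} {n : ℕ} {M : ModuleCat.{0} R} {H H' : Type}
    [AddCommGroup H] [Module R H] [AddCommGroup H'] [Module R H']
    {ι : ∀ t, Abelian.Ext (powQuot I t) M n →ₗ[R] H} (hι : IsLocalCohomology I n M ι)
    (e : H ≃ₗ[R] H') : IsLocalCohomology I n M fun t => e.toLinearMap ∘ₗ ι t where
  compat h α := congrArg e (hι.compat h α)
  surj x := by
    obtain ⟨t, α, h⟩ := hι.surj (e.symm x)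
    exact ⟨t, α, by rw [LinearMap.comp_apply, h, LinearEquiv.coe_coe, e.apply_symm_apply]⟩
  eq_zero t α h := hι.eq_zero t α ((map_eq_zero_iff e e.injective).1 h)

open Abelian in
/-- Local duality, relating `Ext` into `ω` of a module with that of its local cohomology. -/
theorem IsLocalCohomology.nonempty_ext_linearEquiv [IsNoetherianRing R] {I : Ideal R}
    {ω : ModuleCat.{0} R} {d : ℕ}
    (hT : ∀ T : ModuleCat.{0} R, IsIdealTorsion I T → ∀ i < d, Subsingleton (Abelian.Ext T ω i))
    (hd : ∀ N : ModuleCat.{0} R, Subsingleton (Abelian.Ext N ω (d + 1)))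
    (hJ : ∀ J : ModuleCat.{0} R, Injective J → ∀ i,
      Subsingleton (Abelian.Ext (ModuleCat.of R (J ⧸ idealTorsion I J)) ω i)) (j : ℕ) :
    ∀ {i : ℕ} (_ : j + i = d) {M : ModuleCat.{0} R} {H : Type} [AddCommGroup H] [Module R H]
      {ι : ∀ t, Abelian.Ext (powQuot I t) M j →ₗ[R] H} (_ : IsLocalCohomology I j M ι),
      Nonempty (Abelian.Ext M ω i ≃ₗ[R] Abelian.Ext (ModuleCat.of R H) ω d) := by
  induction j with
  | zero =>
    intro i hi M H _ _ ι hι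
    obtain rfl : i = d := by lia
    obtain ⟨ι', hι'⟩ := isLocalCohomology_zero I M
    obtain ⟨e⟩ := hι.nonempty_linearEquiv hι'
    obtain ⟨e'⟩ := nonempty_ext_linearEquiv_of_iso (X := ModuleCat.of R H) e.toModuleIso ω i
    have hS := quotSES_shortExact (idealTorsion I M)
    obtain ⟨J, f, hJi, hf⟩ := exists_local_embedding I
      (M := (quotSES (idealTorsion I M)).X₃) (idealTorsion_quotient_eq_bot I M)
    have hS' := cokerSES_shortExact f hf
    have : Subsingleton (Abelian.Ext (quotSES (idealTorsion I M)).X₃ ω i) := by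
      refine subsingleton_of_forall_eq 0 fun α => ?_
      obtain ⟨β, rfl⟩ := Ext.contravariant_sequence_exact₁ hS' ω α (add_comm 1 i)
        ((hd _).elim _ _)
      rw [(hJ J hJi i).elim β 0, Ext.comp_zero]
    exact ⟨(LinearEquiv.ofBijective _ (bijective_extRes_f hS ω i this (hd _))).trans e'⟩
  | succ j ih =>
    intro i hi M H _ _ ι hι
    have hS := quotSES_shortExact (idealTorsion I M)
    obtain ⟨J, f, hJi, hf⟩ := exists_local_embedding I
      (M := (quotSES (idealTorsion I M)).X₃) (idealTorsion_quotient_eq_bot I M)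
    have hS' := cokerSES_shortExact f hf
    have hΓ := isIdealTorsion_idealTorsion I M
    obtain ⟨ι₁, hι₁⟩ := exists_isLocalCohomology I (j + 1) (quotSES (idealTorsion I M)).X₃
    obtain ⟨ι₂, hι₂⟩ := hι₁.of_quotient_torsion hS hΓ
    obtain ⟨e⟩ := hι₂.nonempty_linearEquiv hι
    obtain ⟨ι₃, hι₃⟩ := (hι₁.congr e).shift hS' (isIdealLocal_quotient I hJi)
    obtain ⟨e'⟩ := ih (i := i + 1) (by lia) hι₃
    have h1 := bijective_extRes_g hS ω i fun k hk => hT _ hΓ k (by lia)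
    have h2 := bijective_extClass_comp hS' ω i (hJ J hJi i) (hJ J hJi (i + 1))
    exact ⟨(LinearEquiv.ofBijective _ h1).symm.trans ((LinearEquiv.ofBijective _ h2).trans e')⟩

open Abelian in
lemma exists_extension {I : Ideal R} {E : Type} [AddCommGroup E] [Module R E]
    (hE : ∀ N : ModuleCat.{0} R, IsIdealTorsion I N →
      Subsingleton (Abelian.Ext N (ModuleCat.of R E) 1))
    {A B : Type} [AddCommGroup A] [Module R A] [AddCommGroup B] [Module R B]
    (hB : IsIdealTorsion I B) {f : A →ₗ[R] B} (hf : Function.Injective f) (g : A →ₗ[R] E) :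
    ∃ h : B →ₗ[R] E, h ∘ₗ f = g := by
  have hS := cokerSES_shortExact (ModuleCat.ofHom f) hf
  obtain ⟨β, hβ⟩ := Ext.contravariant_sequence_exact₁ hS (ModuleCat.of R E)
    (Ext.mk₀ (ModuleCat.ofHom g)) (add_comm 1 0)
    ((hE _ (hB.of_surjective _ (Submodule.mkQ_surjective _))).elim _ _)
  obtain ⟨h, rfl⟩ := (Ext.mk₀_bijective _ _).2 β
  rw [Ext.mk₀_comp_mk₀] at hβ
  exact ⟨h.hom, congrArg ModuleCat.Hom.hom ((Ext.mk₀_bijective _ _).1 hβ)⟩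

section Socle

open IsLocalRing

variable [IsLocalRing R] {T : Type} [AddCommGroup T] [Module R T]

lemma isTorsionBySet_residueField_hom :
    Module.IsTorsionBySet R (ResidueField R →ₗ[R] T) (maximalIdeal R : Set R) := by
  rintro f ⟨r, hr⟩
  refine LinearMap.ext fun y => (map_smul f r y).symm.trans ?_
  have : r • y = 0 := by
    rw [Algebra.smul_def]
    exact (congrArg (· * y) ((residue_eq_zero_iff r).2 hr)).trans (zero_mul y)
  rw [this, map_zero, LinearMap.zero_apply]

/-- The socle of a module, as a vector space over the residue field. -/
instance socleModule : Module (ResidueField R) (ResidueField R →ₗ[R] T) :=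
  isTorsionBySet_residueField_hom.module

instance isScalarTower_socle : IsScalarTower R (ResidueField R) (ResidueField R →ₗ[R] T) :=
  isTorsionBySet_residueField_hom.isScalarTower

lemma socle_eval_injective :
    Function.Injective (LinearMap.applyₗ (R := R) (M₂ := T) (1 : ResidueField R)) := by
  intro f g h
  refine LinearMap.ext fun y => ?_
  obtain ⟨r, rfl⟩ := residue_surjective y
  have : residue R r = r • 1 := by rw [Algebra.smul_def, mul_one]; rfl
  rw [this, map_smul, map_smul]
  exact congrArg (r • ·) h

lemma exists_socle_eval_eq {t : T} (ht : ∀ r ∈ maximalIdeal R, r • t = 0) :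
    ∃ f : ResidueField R →ₗ[R] T, f 1 = t :=
  ⟨Submodule.liftQ (maximalIdeal R) (LinearMap.toSpanSingleton R T t) ht, one_smul R t⟩

lemma eq_zero_of_socle_injective {E : Type} [AddCommGroup E] [Module R E] (Φ : T →ₗ[R] E)
    (hΦ : ∀ f : ResidueField R →ₗ[R] T, Φ (f 1) = 0 → f 1 = 0) (s : ℕ) :
    ∀ t : T, (∀ r ∈ maximalIdeal R ^ s, r • t = 0) → Φ t = 0 → t = 0 := by
  induction s with
  | zero => exact fun t ht _ => by simpa using ht 1 (by simp)
  | succ s ih =>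
    intro t ht h0
    have : ∀ r ∈ maximalIdeal R, r • t = 0 := fun r hr =>
      ih _ (fun u hu => by
        rw [smul_smul]
        exact ht _ (by rw [pow_succ]; exact Ideal.mul_mem_mul hu hr))
        (by rw [map_smul, h0, smul_zero])
    obtain ⟨f, rfl⟩ := exists_socle_eval_eq this
    exact hΦ f h0

variable [IsNoetherianRing R]

/-- If `E` behaves like an injective hull of the residue field on torsion modules, then
`Hom(T, E)` is finite if and only if the socle of `T` is. -/
theorem finite_hom_iff_finite_socle {E : Type} [AddCommGroup E] [Module R E]
    (hEt : IsIdealTorsion (maximalIdeal R) E)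
    (hE : ∀ N : ModuleCat.{0} R, IsIdealTorsion (maximalIdeal R) N →
      Subsingleton (Abelian.Ext N (ModuleCat.of R E) 1))
    [hk : Nontrivial (ResidueField R →ₗ[R] E)] [Module.Finite R (Module.End R E)]
    (hT : IsIdealTorsion (maximalIdeal R) T) :
    Module.Finite R (T →ₗ[R] E) ↔ Module.Finite R (ResidueField R →ₗ[R] T) := by
  let ev := LinearMap.applyₗ (R := R) (M₂ := T) (1 : ResidueField R)
  obtain ⟨i, hi⟩ := exists_ne (0 : ResidueField R →ₗ[R] E)
  have hi' : Function.Injective i := by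
    refine (injective_iff_map_eq_zero i).2 fun y hy => by_contra fun hy0 => hi ?_
    refine LinearMap.ext fun z => ?_
    obtain ⟨r, hr⟩ := residue_surjective (z * y⁻¹)
    have : z = r • y := by
      rw [Algebra.smul_def]
      exact (inv_mul_cancel_right₀ hy0 z).symm.trans (congrArg (· * y) hr.symm)
    rw [this, map_smul, hy, smul_zero, LinearMap.zero_apply]
  constructor
  · intro h
    have h1 : Module.Finite R ((ResidueField R →ₗ[R] T) →ₗ[R] E) :=
      Module.Finite.of_surjective (LinearMap.lcomp R E ev) fun g =>
        exists_extension hE hT socle_eval_injective g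
    let φ : Module.Dual (ResidueField R) (ResidueField R →ₗ[R] T) →ₗ[R]
        ((ResidueField R →ₗ[R] T) →ₗ[R] E) :=
      { toFun f := i ∘ₗ f.restrictScalars R
        map_add' f g := LinearMap.ext fun x => map_add i _ _
        map_smul' r f := LinearMap.ext fun x => map_smul i r _ }
    have hφ : Function.Injective φ := fun f g h =>
      LinearMap.ext fun x => hi' congr($h x)
    have h2 := Module.Finite.of_injective φ hφ
    have h3 := Module.Finite.of_restrictScalars_finite R (ResidueField R)
      (Module.Dual (ResidueField R) (ResidueField R →ₗ[R] T))
    have h4 := (Module.finite_dual_iff (ResidueField R)).1 h3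
    exact Module.Finite.trans (ResidueField R) _
  · intro h
    have h1 := Module.Finite.of_restrictScalars_finite R (ResidueField R) (ResidueField R →ₗ[R] T)
    let b := Module.finBasis (ResidueField R) (ResidueField R →ₗ[R] T)
    choose Φ hΦ using fun j => exists_extension hE hT (f := ev) socle_eval_injective
      (i ∘ₗ (b.coord j).restrictScalars R)
    have hΦi : Function.Injective (LinearMap.pi Φ) := by
      refine (injective_iff_map_eq_zero _).2 fun t ht => ?_
      obtain ⟨s, hs⟩ := hT t
      refine eq_zero_of_socle_injective (LinearMap.pi Φ) (fun f hf => ?_) s t hs ht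
      have : f = 0 := b.forall_coord_eq_zero_iff.1 fun j =>
        hi' ((congr($(hΦ j) f)).symm.trans ((congrFun hf j).trans (map_zero i).symm))
      rw [this, LinearMap.zero_apply]
    have hEn : IsIdealTorsion (maximalIdeal R)
        (Fin (Module.finrank (ResidueField R) (ResidueField R →ₗ[R] T)) → E) := by
      intro y
      choose s hs using fun j => hEt (y j)
      exact ⟨Finset.univ.sup s, fun r hr => funext fun j =>
        hs j r (Ideal.pow_le_pow_right (Finset.le_sup (Finset.mem_univ j)) hr)⟩
    have := Module.Finite.equiv (LinearMap.lsum R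
      (fun _ : Fin (Module.finrank (ResidueField R) (ResidueField R →ₗ[R] T)) => E) R (M := E))
    exact Module.Finite.of_surjective (LinearMap.lcomp R E (LinearMap.pi Φ)) fun g =>
      exists_extension hE hEn hΦi g

end Socle

lemma exists_isRegular_of_idealGrade_eq [Nontrivial R] {J : Ideal R} {g : ℕ}
    (hg : idealGrade J = g) : ∃ rs : List R, (∀ r ∈ rs, r ∈ J) ∧
      RingTheory.Sequence.IsRegular R rs ∧ rs.length = g := by
  have : Nonempty {c : ℕ∞ | ∃ rs : List R, (∀ r ∈ rs, r ∈ J) ∧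
      RingTheory.Sequence.IsRegular R rs ∧ (rs.length : ℕ∞) = c} :=
    ⟨0, [], by simp, RingTheory.Sequence.IsRegular.nil R R, by simp⟩
  obtain ⟨rs, h1, h2, h3⟩ := ENat.sSup_mem_of_nonempty_of_lt_top
    (hg.trans_lt (ENat.natCast_lt_top g))
  exact ⟨rs, h1, h2, by exact_mod_cast h3.trans hg⟩

section Canonical

open IsLocalRing

variable [IsLocalRing R] [IsNoetherianRing R]

lemma idealGrade_le_of_ringKrullDim_eq {d : ℕ} (hd : ringKrullDim R = (d : WithBot ℕ∞))
    {J : Ideal R} {g : ℕ} (hg : idealGrade J = g) : g ≤ d := by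
  obtain ⟨rs, -, hrs, rfl⟩ := exists_isRegular_of_idealGrade_eq hg
  have hm : Ideal.ofList rs ≤ maximalIdeal R :=
    le_maximalIdeal fun h => hrs.top_ne_smul (by rw [h, Submodule.top_smul])
  have h := ringKrullDim_quotient_add_le_of_isRegular hrs
    (q := maximalIdeal R) fun r hr => hm (Ideal.subset_span hr)
  rw [hd, show ringKrullDim (R ⧸ maximalIdeal R) = 0 from
    ringKrullDim_eq_zero_of_field (ResidueField R), zero_add] at h
  exact_mod_cast h

variable {ω : ModuleCat.{0} R} [Module.Finite R ω] {d : ℕ}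

lemma subsingleton_ext_succ_of_residueField
    (hM : ∀ i ≠ d, Subsingleton (Abelian.Ext (ModuleCat.of R (ResidueField R)) ω i))
    (N : ModuleCat.{0} R) : Subsingleton (Abelian.Ext N ω (d + 1)) :=
  subsingleton_ext_of_forall_ideal d (fun _ => subsingleton_ext_of_forall_prime fun q hq _ =>
    subsingleton_ext_quotient_prime hM q hq _ (.inl d.lt_succ_self)) N

lemma subsingleton_ext_powQuot_of_lt_idealGrade (hd : ringKrullDim R = (d : WithBot ℕ∞))
    (hM : ∀ i ≠ d, Subsingleton (Abelian.Ext (ModuleCat.of R (ResidueField R)) ω i))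
    {J : Ideal R} {g : ℕ} (hg : idealGrade J = g) (i : ℕ) (hi : i < g) (t : ℕ) :
    Subsingleton (Abelian.Ext (powQuot J t) ω i) := by
  have : Module.Finite R (powQuot J t) := inferInstanceAs (Module.Finite R (R ⧸ J ^ t))
  refine subsingleton_ext_of_forall_prime fun q hq hann =>
    subsingleton_ext_quotient_prime hM q hq i (.inr ?_)
  obtain ⟨rs, hJ, hrs, rfl⟩ := exists_isRegular_of_idealGrade_eq hg
  have hJq : J ≤ q := hq.le_of_pow_le ((Ideal.annihilator_quotient (I := J ^ t)).ge.trans hann)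
  have h := ringKrullDim_quotient_add_le_of_isRegular hrs fun r hr => hJq (hJ r hr)
  rw [hd] at h
  generalize ringKrullDim (R ⧸ q) = x at h ⊢
  cases x with
  | bot => exact WithBot.bot_lt_coe _
  | coe x =>
    cases x with
    | top =>
      have h' : (⊤ : ℕ∞) + rs.length ≤ d := by exact_mod_cast h
      simp at h'
    | coe x =>
      norm_cast at h ⊢
      lia

end Canonical

end

/- `(R, 𝔪, 𝕜)` is a `d`-dimensional complete local Cohen-Macaulay ring (Cohen-Macaulayness
being expressed as `grade 𝔪 = d = dim R`) with canonical module `ω`, `I ⊆ R` is an ideal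
with `c = grade I`, and `H^c_I(ω) ≠ 0`. -/
variable (R : Type) [CommRing R] [IsLocalRing R] [IsNoetherianRing R]
  [IsAdicComplete (IsLocalRing.maximalIdeal R) R]

/-- the endomorphism ring `Hom_R(H^c_I(ω_R), H^c_I(ω_R))` is a finitely
generated `R`-module if and only if the socle `Hom_R(𝕜, H^{d-c}_𝔪(H^c_I(ω_R)))` is a
finite-dimensional `𝕜`-vector space.  The socle is annihilated by `𝔪`, so finite
dimensionality over `𝕜 = R/𝔪` is equivalent to finite generation as an `R`-module. -/
theorem statement18 (d : ℕ) (hd : ringKrullDim R = (d : WithBot ℕ∞))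
    (hCM : idealGrade (IsLocalRing.maximalIdeal R) = (d : ℕ∞))
    (ω : ModuleCat R) (hω : IsCanonicalModule R d ω)
    (I : Ideal R) (c : ℕ) (hc : idealGrade I = (c : ℕ∞))
    (hne : ¬ Subsingleton ((localCohomology I c).obj ω)) :
    Module.Finite R (Module.End R ((localCohomology I c).obj ω)) ↔
      Module.Finite R
        (IsLocalRing.ResidueField R →ₗ[R]
          ((localCohomology (IsLocalRing.maximalIdeal R) (d - c)).obj
            ((localCohomology I c).obj ω))) := by
  obtain ⟨hfin, hvan, ⟨ed⟩⟩ := hω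
  let P := projectiveResolution (ModuleCat.of R (IsLocalRing.ResidueField R))
  have hM : ∀ i ≠ d, Subsingleton
      (Abelian.Ext (ModuleCat.of R (IsLocalRing.ResidueField R)) ω i) := fun i hi =>
    have := hvan i hi
    (P.extLinearEquiv ω i).symm.injective.subsingleton
  have hvan_top := subsingleton_ext_succ_of_residueField hM
  have hvan_lt {J : Ideal R} {g : ℕ} (hg : idealGrade J = g) :=
    subsingleton_ext_powQuot_of_lt_idealGrade hd hM hg
  have hcd := idealGrade_le_of_ringKrullDim_eq hd hc
  obtain ⟨ιI, hιI⟩ := exists_isLocalCohomology I c ω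
  obtain ⟨ιE, hιE⟩ := exists_isLocalCohomology (IsLocalRing.maximalIdeal R) d ω
  obtain ⟨ιT, hιT⟩ := exists_isLocalCohomology (IsLocalRing.maximalIdeal R) (d - c)
    ((localCohomology I c).obj ω)
  have hE {N : ModuleCat.{0} R} := IsLocalCohomology.lowest d (hvan_lt hCM) hιE (N := N)
  have hdual {j i : ℕ} (hij : j + i = d) {M : ModuleCat.{0} R} {H : Type} [AddCommGroup H]
      [Module R H] {ι} (hι : IsLocalCohomology (IsLocalRing.maximalIdeal R) j M (H := H) ι) :=
    IsLocalCohomology.nonempty_ext_linearEquiv (fun _ hN => (hE hN).1) hvan_top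
      (fun _ hJ => subsingleton_ext_quotient_idealTorsion le_rfl hJ) j hij hι
  have hk : IsIdealTorsion (IsLocalRing.maximalIdeal R) (IsLocalRing.ResidueField R) :=
    (isIdealTorsion_powQuot (IsLocalRing.maximalIdeal R) 1).of_surjective
      (Submodule.factor (pow_one _).le) (Submodule.factor_surjective _)
  obtain ⟨e₁⟩ := (IsLocalCohomology.lowest c (hvan_lt hc) hιI hιI.isIdealTorsion).2.1
  obtain ⟨e₂⟩ := hdual (Nat.sub_add_cancel hcd) hιT
  obtain ⟨e₃⟩ := (hE (N := ModuleCat.of R ((localCohomology (IsLocalRing.maximalIdeal R)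
    (d - c)).obj ((localCohomology I c).obj ω))) hιT.isIdealTorsion).2.1
  obtain ⟨ek⟩ := (hE (N := ModuleCat.of R (IsLocalRing.ResidueField R)) hk).2.1
  obtain ⟨f₁⟩ := (hE (N := ModuleCat.of R ((localCohomology (IsLocalRing.maximalIdeal R)
    d).obj ω)) hιE.isIdealTorsion).2.1
  obtain ⟨f₂⟩ := hdual (add_zero d) hιE
  obtain ⟨f₃⟩ := nonempty_ext_zero_linearEquiv ω ω
  have : Module.Finite R (Module.End R ((localCohomology (IsLocalRing.maximalIdeal R) d).obj ω)) :=
    Module.Finite.equiv (f₃.symm ≪≫ₗ f₂ ≪≫ₗ f₁)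
  have : Nontrivial (IsLocalRing.ResidueField R →ₗ[R]
      ((localCohomology (IsLocalRing.maximalIdeal R) d).obj ω)) :=
    ((ed.symm ≪≫ₗ P.extLinearEquiv ω d) ≪≫ₗ ek).symm.surjective.nontrivial
  rw [← finite_hom_iff_finite_socle hιE.isIdealTorsion
    (fun N hN => (hE hN).2.2 (hvan_top N)) hιT.isIdealTorsion]
  exact Module.Finite.equiv_iff (e₁.symm ≪≫ₗ e₂ ≪≫ₗ e₃)
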